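/- arXiv:1607.02518 — 2 statements merged into one kernel-verified Lean document; each statement's English description precedes it below -/
import Mathlib

section
/- Let n ≥ 1, let F be a field, and let x_1, …, x_n be pairwise distinct elements of F. Then for every integer k ≥ 0, ∑_{i=1}^n x_i^{k+n−1} ∏_{j≠i} (x_i − x_j)^{−1} = h_k(x_1, …, x_n), where h_k is the complete homogeneous symmetric polynomial of degree k. -/
section

open Finset

theorem sum_antidiagonalTuple_succ_prod {R : Type*} [CommSemiring R] {n : ℕ}
    (x : Fin (n + 1) → R) (k : ℕ) :
    ∑ d ∈ Nat.antidiagonalTuple (n + 1) k, ∏ i, x i ^ d i =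
      ∑ p ∈ antidiagonal k, x 0 ^ p.1 *
        ∑ d ∈ Nat.antidiagonalTuple n p.2, ∏ i, x (Fin.succ i) ^ d i := by
  simp_rw [Finset.mul_sum]
  rw [Finset.sum_sigma']
  symm
  refine Finset.sum_bij' (fun q _ => Fin.cons q.1.1 q.2)
    (fun d _ => ⟨(d 0, ∑ i, d (Fin.succ i)), Fin.tail d⟩) ?_ ?_ ?_ ?_ ?_
  · rintro ⟨⟨a, b⟩, d⟩ h
    simp only [mem_sigma, HasAntidiagonal.mem_antidiagonal, Nat.mem_antidiagonalTuple] at h ⊢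
    simp [Fin.sum_univ_succ, h]
  · intro d h
    simp only [mem_sigma, HasAntidiagonal.mem_antidiagonal, Nat.mem_antidiagonalTuple] at h ⊢
    exact ⟨by rw [← h, Fin.sum_univ_succ], rfl⟩
  · rintro ⟨⟨a, b⟩, d⟩ h
    simp only [mem_sigma, HasAntidiagonal.mem_antidiagonal, Nat.mem_antidiagonalTuple] at h
    simp [h]
  · intro d _
    exact Fin.cons_self_tail d
  · rintro ⟨⟨a, b⟩, d⟩ _
    simp [Fin.prod_univ_succ]

theorem sum_antidiagonalTuple_succ_prod_succ {R : Type*} [CommSemiring R] {n : ℕ}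
    (x : Fin (n + 1) → R) (k : ℕ) :
    ∑ d ∈ Nat.antidiagonalTuple (n + 1) (k + 1), ∏ i, x i ^ d i =
      x 0 * ∑ d ∈ Nat.antidiagonalTuple (n + 1) k, ∏ i, x i ^ d i +
        ∑ d ∈ Nat.antidiagonalTuple n (k + 1), ∏ i, x (Fin.succ i) ^ d i := by
  rw [sum_antidiagonalTuple_succ_prod, sum_antidiagonalTuple_succ_prod,
    Nat.sum_antidiagonal_succ, add_comm]
  simp only [pow_zero, one_mul, pow_succ', mul_assoc, ← Finset.mul_sum]

theorem sum_pow_mul_prod_inv_sub_succ {F : Type*} [Field F] {n : ℕ}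
    (x : Fin (n + 1) → F) (hx : Function.Injective x) (m : ℕ) :
    ∑ i, x i ^ (m + 1) * ∏ j ∈ univ.erase i, (x i - x j)⁻¹ =
      x 0 * ∑ i, x i ^ m * ∏ j ∈ univ.erase i, (x i - x j)⁻¹ +
        ∑ i : Fin n, x i.succ ^ m * ∏ j ∈ univ.erase i, (x i.succ - x j.succ)⁻¹ := by
  have key (i : Fin n) : ∏ j ∈ univ.erase i.succ, (x i.succ - x j)⁻¹ =
      (x i.succ - x 0)⁻¹ * ∏ j ∈ univ.erase i, (x i.succ - x j.succ)⁻¹ := by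
    have h : univ.erase i.succ = insert 0 ((univ.erase i).map (Fin.succEmb n)) := by
      ext j
      cases j using Fin.cases <;> simp [Fin.succ_ne_zero, eq_comm]
    rw [h, prod_insert (by simp), prod_map]
    rfl
  have hne (i : Fin n) : x i.succ - x 0 ≠ 0 := sub_ne_zero.2 (hx.ne (Fin.succ_ne_zero i))
  rw [Fin.sum_univ_succ, Fin.sum_univ_succ (n := n) (f := fun i => x i ^ m * _), mul_add,
    add_assoc, Finset.mul_sum, ← Finset.sum_add_distrib]
  congr 1
  · ring
  · refine Finset.sum_congr rfl fun i _ => ?_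
    rw [key]
    have := hne i
    field_simp
    ring

theorem sum_pow_mul_prod_inv_sub_eq_one {F : Type*} [Field F] {n : ℕ}
    (x : Fin (n + 1) → F) (hx : Function.Injective x) :
    ∑ i, x i ^ n * ∏ j ∈ univ.erase i, (x i - x j)⁻¹ = 1 := by
  have h := Lagrange.leadingCoeff_eq_sum (s := univ) (v := x) hx.injOn
    (P := (Polynomial.X : Polynomial F) ^ n) (by simp)
  simpa [div_eq_mul_inv] using h.symm

theorem sum_pow_add_mul_prod_inv_sub {F : Type*} [Field F] {n : ℕ}
    (x : Fin (n + 1) → F) (hx : Function.Injective x) (k : ℕ) :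
    ∑ i, x i ^ (k + n) * ∏ j ∈ univ.erase i, (x i - x j)⁻¹ =
      ∑ d ∈ Nat.antidiagonalTuple (n + 1) k, ∏ i, x i ^ d i := by
  induction n generalizing k with
  | zero => simp
  | succ n ihn =>
    induction k with
    | zero =>
      rw [zero_add, sum_pow_mul_prod_inv_sub_eq_one x hx, Nat.antidiagonalTuple_zero_right]
      simp
    | succ k ihk =>
      rw [show k + 1 + (n + 1) = k + (n + 1) + 1 by omega, sum_pow_mul_prod_inv_sub_succ x hx, ihk,
        sum_antidiagonalTuple_succ_prod_succ, ← ihn (fun i => x i.succ)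
          (hx.comp (Fin.succ_injective _)), show k + 1 + n = k + (n + 1) by omega]

end

/-- For `n ≥ 1` and pairwise distinct `x₁, …, xₙ` in a field `F`, and any `k ≥ 0`,
`∑ i, x i ^ (k + n - 1) * ∏_{j ≠ i} (x i - x j)⁻¹` equals the complete homogeneous
symmetric polynomial `h_k(x₁, …, xₙ) = ∑_{d₁+⋯+dₙ = k} x₁^{d₁} ⋯ xₙ^{dₙ}`. -/
theorem stmt0 (n : ℕ) (hn : 1 ≤ n) (F : Type*) [Field F] (x : Fin n → F)
    (hx : Function.Injective x) (k : ℕ) :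
    ∑ i : Fin n, x i ^ (k + n - 1) * ∏ j ∈ Finset.univ.erase i, (x i - x j)⁻¹ =
      ∑ d ∈ Finset.Nat.antidiagonalTuple n k, ∏ i : Fin n, x i ^ d i := by
  obtain ⟨n, rfl⟩ := Nat.exists_eq_add_of_le' hn
  exact sum_pow_add_mul_prod_inv_sub x hx k
end

section
/- Genus-0 Hurwitz number formula: Let n ≥ 1 and let α = (α_1, …, α_ℓ) be a partition of n with ℓ parts (parts equal to 1 included). Fix a permutation σ of {1, …, n} of cycle type α and set m = n + ℓ − 2. Then the number of transitive factorizations (τ_1, …, τ_m) of σ in which every factor τ_i is a transposition equals, as a rational number, m! · n^{ℓ−3} · ∏_{j=1}^{ℓ} α_j^{α_j} / (α_j − 1)!, where n^{ℓ−3} denotes the integer power (n : ℚ)^{ℓ−3} (the exponent ℓ − 3 may be negative). -/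
namespace Hurwitz

open Finset

section Abel

variable {ι : Type*} [DecidableEq ι]

theorem sum_powerset_sum_mem {M : Type*} [AddCommMonoid M] (S : Finset ι)
    (f : ι → Finset ι → Finset ι → M) :
    ∑ U ∈ S.powerset, ∑ j ∈ U, f j (U.erase j) (S \ U) =
      ∑ j ∈ S, ∑ U ∈ (S.erase j).powerset, f j U (S.erase j \ U) := by
  rw [Finset.sum_sigma', Finset.sum_sigma']
  refine Finset.sum_bij' (fun x _ => ⟨x.2, x.1.erase x.2⟩) (fun x _ => ⟨insert x.1 x.2, x.1⟩)
    ?_ ?_ ?_ ?_ ?_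
  · rintro ⟨U, j⟩ h
    simp only [mem_sigma, mem_powerset] at h ⊢
    exact ⟨h.1 h.2, Finset.erase_subset_erase _ h.1⟩
  · rintro ⟨j, U⟩ h
    simp only [mem_sigma, mem_powerset, mem_insert_self, and_true] at h ⊢
    exact Finset.insert_subset h.1 (h.2.trans (Finset.erase_subset _ _))
  · rintro ⟨U, j⟩ h
    simp only [mem_sigma, mem_powerset] at h ⊢
    simp [Finset.insert_erase h.2]
  · rintro ⟨j, U⟩ h
    simp only [mem_sigma, mem_powerset] at h ⊢
    have : j ∉ U := fun hj => by simpa using h.2 hj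
    simp [Finset.erase_insert this]
  · rintro ⟨U, j⟩ h
    simp only [mem_sigma, mem_powerset] at h ⊢
    congr 1
    ext y
    simp only [mem_sdiff, mem_erase]
    have : y = j → y ∈ U := fun e => e ▸ h.2
    tauto

/-- `(x + ∑_{i ∈ U} b_i) ^ |U|`. -/
def abelF (b : ι → ℚ) (x : ℚ) (U : Finset ι) : ℚ := (x + ∑ i ∈ U, b i) ^ U.card

/-- `x (x + ∑_{i ∈ U} b_i) ^ (|U| - 1)`. -/
def abelE (b : ι → ℚ) (x : ℚ) (U : Finset ι) : ℚ := x * (x + ∑ i ∈ U, b i) ^ ((U.card : ℤ) - 1)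

omit [DecidableEq ι] in
theorem base_ne_zero {b : ι → ℚ} (hb : ∀ i, 0 < b i) {x : ℚ} (hx : 0 < x) (U : Finset ι) :
    x + ∑ i ∈ U, b i ≠ 0 := by
  have := Finset.sum_nonneg (s := U) (fun i _ => (hb i).le)
  positivity

theorem abelF_eq {b : ι → ℚ} (hb : ∀ i, 0 < b i) {x : ℚ} (hx : 0 < x) (U : Finset ι) :
    abelF b x U = abelE b x U + ∑ j ∈ U, b j * abelF b (x + b j) (U.erase j) := by
  have h0 := base_ne_zero hb hx U
  have h1 : ∀ j ∈ U, b j * abelF b (x + b j) (U.erase j) =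
      b j * (x + ∑ i ∈ U, b i) ^ ((U.card : ℤ) - 1) := by
    intro j hj
    rw [abelF, add_assoc, Finset.add_sum_erase _ _ hj, Finset.card_erase_of_mem hj,
      ← zpow_natCast, Nat.cast_sub (Finset.card_pos.2 ⟨j, hj⟩)]
    simp
  rw [Finset.sum_congr rfl h1, ← Finset.sum_mul, abelE, ← add_mul, abelF, ← zpow_natCast,
    zpow_sub_one₀ h0]
  field_simp

theorem abelE_eq {b : ι → ℚ} (hb : ∀ i, 0 < b i) {x : ℚ} (hx : 0 < x) (U : Finset ι) :
    abelE b x U = abelF b x U - ∑ j ∈ U, b j * abelF b (x + b j) (U.erase j) := by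
  rw [abelF_eq hb hx U]; ring

theorem abel_aux {b : ι → ℚ} (hb : ∀ i, 0 < b i) (n : ℕ) : ∀ S : Finset ι, S.card = n →
    (∀ x y, 0 < x → ∑ U ∈ S.powerset, abelE b x U * abelF b y (S \ U) = abelF b (x + y) S) ∧
    (∀ x y x' y', 0 < x → 0 < x' → x + y = x' + y' →
      ∑ U ∈ S.powerset, abelF b x U * abelF b y (S \ U) =
        ∑ U ∈ S.powerset, abelF b x' U * abelF b y' (S \ U)) := by
  induction n with
  | zero =>
    intro S hS
    obtain rfl := Finset.card_eq_zero.1 hS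
    constructor
    · intro x y hx
      simp [abelE, abelF, hx.ne']
    · intros
      simp [abelF]
  | succ n ih =>
    intro S hS
    have key : ∀ x y, 0 < x →
        ∑ U ∈ S.powerset, abelE b x U * abelF b y (S \ U) = abelF b (x + y) S := by
      intro x y hx
      obtain ⟨j, S', hj, rfl, hS'⟩ := Finset.card_eq_succ.1 hS
      obtain ⟨ih1, ih2⟩ := ih S' hS'
      rw [Finset.sum_powerset_insert hj]
      have e1 : ∀ U ∈ S'.powerset, abelE b x U * abelF b y (insert j S' \ U) =
          (x + y + b j + ∑ i ∈ S', b i) * (abelE b x U * abelF b (y + b j) (S' \ U)) -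
            x * (abelF b x U * abelF b (y + b j) (S' \ U)) := by
        intro U hU
        have hUS := Finset.mem_powerset.1 hU
        have hjU : j ∉ U := fun h => hj (hUS h)
        have h0 := base_ne_zero hb hx U
        rw [Finset.insert_sdiff_of_notMem _ hjU, abelE, abelF, abelF, abelF,
          Finset.sum_insert (by simp [hj]), Finset.card_insert_of_notMem (by simp [hj]),
          ← Finset.sum_sdiff hUS, zpow_sub_one₀ h0, zpow_natCast]
        field_simp
        ring
      have e2 : ∀ U ∈ S'.powerset, abelE b x (insert j U) * abelF b y (insert j S' \ insert j U) =
          x * (abelF b (x + b j) U * abelF b y (S' \ U)) := by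
        intro U hU
        have hUS := Finset.mem_powerset.1 hU
        have hjU : j ∉ U := fun h => hj (hUS h)
        rw [Finset.insert_sdiff_insert, Finset.sdiff_insert_of_notMem hj, abelE,
          Finset.sum_insert hjU, Finset.card_insert_of_notMem hjU, abelF, abelF]
        push_cast
        rw [add_sub_cancel_right, zpow_natCast]
        ring
      rw [Finset.sum_congr rfl e1, Finset.sum_congr rfl e2, Finset.sum_sub_distrib,
        ← Finset.mul_sum, ← Finset.mul_sum, ← Finset.mul_sum, ih1 x _ hx,
        ih2 x (y + b j) (x + b j) y hx (add_pos hx (hb j)) (by ring), sub_add_cancel,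
        abelF, abelF, Finset.sum_insert hj, Finset.card_insert_of_notMem hj]
      ring
    refine ⟨key, fun x y x' y' hx hx' hxy => ?_⟩
    have expand : ∀ x y, 0 < x → ∑ U ∈ S.powerset, abelF b x U * abelF b y (S \ U) =
        abelF b (x + y) S + ∑ j ∈ S, b j * ∑ U ∈ (S.erase j).powerset,
          abelF b (x + b j) U * abelF b y (S.erase j \ U) := by
      intro x y hx
      rw [← key x y hx]
      simp_rw [Finset.mul_sum]
      rw [← sum_powerset_sum_mem S
        (fun j U V => b j * (abelF b (x + b j) U * abelF b y V)), ← Finset.sum_add_distrib]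
      refine Finset.sum_congr rfl fun U _ => ?_
      rw [abelF_eq hb hx U, add_mul, Finset.sum_mul]
      simp_rw [mul_assoc]
    rw [expand x y hx, expand x' y' hx', hxy]
    congr 1
    refine Finset.sum_congr rfl fun j hj => ?_
    congr 1
    refine (ih (S.erase j) ?_).2 _ _ _ _ (add_pos hx (hb j)) (add_pos hx' (hb j)) (by linarith)
    rw [Finset.card_erase_of_mem hj, hS]; rfl

theorem sum_abelE_mul_abelF {b : ι → ℚ} (hb : ∀ i, 0 < b i) (S : Finset ι) {x : ℚ} (hx : 0 < x)
    (y : ℚ) : ∑ U ∈ S.powerset, abelE b x U * abelF b y (S \ U) = abelF b (x + y) S :=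
  (abel_aux hb _ S rfl).1 x y hx

/-- Powersets are symmetric under complementation. -/
theorem sum_powerset_sdiff {M : Type*} [AddCommMonoid M] (S : Finset ι)
    (f : Finset ι → Finset ι → M) :
    ∑ U ∈ S.powerset, f U (S \ U) = ∑ U ∈ S.powerset, f (S \ U) U := by
  refine Finset.sum_bij' (fun U _ => S \ U) (fun U _ => S \ U) ?_ ?_ ?_ ?_ ?_
  · simp
  · simp
  · intro U hU; simpa using hU
  · intro U hU; simpa using hU
  · intro U hU; simp [Finset.inter_eq_right.2 (Finset.mem_powerset.1 hU)]

theorem sum_abelE_mul_abelE {b : ι → ℚ} (hb : ∀ i, 0 < b i) (S : Finset ι) {x y : ℚ} (hx : 0 < x)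
    (hy : 0 < y) : ∑ U ∈ S.powerset, abelE b x U * abelE b y (S \ U) = abelE b (x + y) S := by
  have : ∀ U ∈ S.powerset, abelE b x U * abelE b y (S \ U) = abelE b x U * abelF b y (S \ U) -
      ∑ j ∈ S \ U, b j * (abelF b (y + b j) ((S \ U).erase j) * abelE b x U) := by
    intro U _
    rw [abelE_eq hb hy, mul_sub, Finset.mul_sum]
    congr 1
    exact Finset.sum_congr rfl fun j _ => by ring
  rw [Finset.sum_congr rfl this, Finset.sum_sub_distrib, sum_abelE_mul_abelF hb S hx,
    sum_powerset_sdiff S (fun U V => ∑ j ∈ V, b j * (abelF b (y + b j) (V.erase j) * abelE b x U))]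
  rw [sum_powerset_sum_mem S (fun j U V => b j * (abelF b (y + b j) U * abelE b x V)),
    abelE_eq hb (add_pos hx hy)]
  congr 1
  refine Finset.sum_congr rfl fun j _ => ?_
  rw [← sum_powerset_sdiff (S.erase j) (fun U V => b j * (abelF b (y + b j) V * abelE b x U)),
    ← Finset.mul_sum, add_assoc, ← sum_abelE_mul_abelF hb (S.erase j) hx]
  congr 1
  exact Finset.sum_congr rfl fun U _ => mul_comm _ _

end Abel

section Abel

variable {ι : Type*} [DecidableEq ι]

theorem sum_powerset_sum_sdiff {M : Type*} [AddCommMonoid M] (S : Finset ι)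
    (f : ι → Finset ι → Finset ι → M) :
    ∑ U ∈ S.powerset, ∑ j ∈ S \ U, f j U ((S \ U).erase j) =
      ∑ j ∈ S, ∑ U ∈ (S.erase j).powerset, f j U (S.erase j \ U) := by
  rw [sum_powerset_sdiff S (fun U V => ∑ j ∈ V, f j U (V.erase j)),
    sum_powerset_sum_mem S (fun j U V => f j V U)]
  exact Finset.sum_congr rfl fun j _ => (sum_powerset_sdiff _ (fun U V => f j U V)).symm

/-- `(x + ∑_{i ∈ U} b_i) ^ (|U| - 2)`. -/
def abelD (b : ι → ℚ) (x : ℚ) (U : Finset ι) : ℚ := (x + ∑ i ∈ U, b i) ^ ((U.card : ℤ) - 2)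

theorem abelD_eq {b : ι → ℚ} (hb : ∀ i, 0 < b i) {x : ℚ} (hx : 0 < x) (U : Finset ι) :
    abelD b x U = x⁻¹ * x⁻¹ * abelE b x U -
      ∑ j ∈ U, x⁻¹ * (b j * (x + b j)⁻¹) * abelE b (x + b j) (U.erase j) := by
  have h0 := base_ne_zero hb hx U
  have h1 : ∀ j ∈ U, x⁻¹ * (b j * (x + b j)⁻¹) * abelE b (x + b j) (U.erase j) =
      b j * (x⁻¹ * (x + ∑ i ∈ U, b i) ^ ((U.card : ℤ) - 2)) := by
    intro j hj
    have := add_pos hx (hb j)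
    rw [abelE, add_assoc x, Finset.add_sum_erase _ _ hj, Finset.card_erase_of_mem hj,
      Nat.cast_sub (Finset.card_pos.2 ⟨j, hj⟩)]
    rw [Nat.cast_one, sub_sub, one_add_one_eq_two]
    field_simp
  rw [Finset.sum_congr rfl h1, ← Finset.sum_mul, abelE, abelD,
    show (U.card : ℤ) - 1 = (U.card - 2) + 1 by ring, zpow_add_one₀ h0]
  field_simp
  ring

theorem sum_abelD_mul_abelD {b : ι → ℚ} (hb : ∀ i, 0 < b i) (S : Finset ι) {x y : ℚ} (hx : 0 < x)
    (hy : 0 < y) : ∑ U ∈ S.powerset, abelD b x U * abelD b y (S \ U) =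
      x⁻¹ * x⁻¹ * (y⁻¹ * y⁻¹) * abelE b (x + y) S
      - ∑ j ∈ S, x⁻¹ * (b j * (x + b j)⁻¹) * (y⁻¹ * y⁻¹) * abelE b (x + y + b j) (S.erase j)
      - ∑ j ∈ S, y⁻¹ * (b j * (y + b j)⁻¹) * (x⁻¹ * x⁻¹) * abelE b (x + y + b j) (S.erase j)
      + ∑ j ∈ S, ∑ k ∈ S.erase j, x⁻¹ * (b j * (x + b j)⁻¹) * (y⁻¹ * (b k * (y + b k)⁻¹)) *
          abelE b (x + y + b j + b k) ((S.erase j).erase k) := by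
  have expand : ∀ U ∈ S.powerset, abelD b x U * abelD b y (S \ U) =
      x⁻¹ * x⁻¹ * (y⁻¹ * y⁻¹) * (abelE b x U * abelE b y (S \ U))
      - ∑ j ∈ U, x⁻¹ * (b j * (x + b j)⁻¹) * (y⁻¹ * y⁻¹) *
          (abelE b (x + b j) (U.erase j) * abelE b y (S \ U))
      - ∑ j ∈ S \ U, y⁻¹ * (b j * (y + b j)⁻¹) * (x⁻¹ * x⁻¹) *
          (abelE b x U * abelE b (y + b j) ((S \ U).erase j))
      + ∑ j ∈ U, ∑ k ∈ S \ U, x⁻¹ * (b j * (x + b j)⁻¹) * (y⁻¹ * (b k * (y + b k)⁻¹)) *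
          (abelE b (x + b j) (U.erase j) * abelE b (y + b k) ((S \ U).erase k)) := by
    intro U _
    rw [abelD_eq hb hx, abelD_eq hb hy, sub_mul, mul_sub, mul_sub, Finset.sum_mul_sum,
      Finset.mul_sum, Finset.sum_mul]
    have e1 : ∀ (s : Finset ι) (f g : ι → ℚ), (∀ i, f i = g i) → ∑ i ∈ s, f i = ∑ i ∈ s, g i :=
      fun s f g h => Finset.sum_congr rfl fun i _ => h i
    rw [sub_sub_eq_add_sub]
    rw [e1 U _ _ fun j => e1 (S \ U) _ _ fun k => by rw [mul_mul_mul_comm]]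
    rw [e1 U (fun j => _ * (_ * abelE b y (S \ U))) _ fun j => by rw [mul_mul_mul_comm]]
    rw [e1 (S \ U) _ _ fun j => by rw [mul_mul_mul_comm]]
    rw [mul_mul_mul_comm]
    rw [e1 (S \ U) (fun j => y⁻¹ * (b j * (y + b j)⁻¹) * (x⁻¹ * x⁻¹) * _) _
      fun j => by rw [mul_comm (y⁻¹ * (b j * (y + b j)⁻¹))]]
    ring
  rw [Finset.sum_congr rfl expand, Finset.sum_add_distrib, Finset.sum_sub_distrib,
    Finset.sum_sub_distrib]
  congr 1; congr 1; congr 1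
  · rw [← Finset.mul_sum, sum_abelE_mul_abelE hb S hx hy]
  · rw [sum_powerset_sum_mem S (fun j U V => x⁻¹ * (b j * (x + b j)⁻¹) * (y⁻¹ * y⁻¹) *
          (abelE b (x + b j) U * abelE b y V))]
    refine Finset.sum_congr rfl fun j _ => ?_
    rw [← Finset.mul_sum, sum_abelE_mul_abelE hb _ (add_pos hx (hb j)) hy]
    congr 2; ring
  · rw [sum_powerset_sum_sdiff S (fun j U V => y⁻¹ * (b j * (y + b j)⁻¹) * (x⁻¹ * x⁻¹) *
          (abelE b x U * abelE b (y + b j) V))]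
    refine Finset.sum_congr rfl fun j _ => ?_
    rw [← Finset.mul_sum, sum_abelE_mul_abelE hb _ hx (add_pos hy (hb j))]
    congr 2; ring
  · rw [sum_powerset_sum_mem S (fun j U V => ∑ k ∈ V,
      x⁻¹ * (b j * (x + b j)⁻¹) * (y⁻¹ * (b k * (y + b k)⁻¹)) *
          (abelE b (x + b j) U * abelE b (y + b k) (V.erase k)))]
    refine Finset.sum_congr rfl fun j _ => ?_
    rw [sum_powerset_sum_sdiff (S.erase j) (fun k U V =>
      x⁻¹ * (b j * (x + b j)⁻¹) * (y⁻¹ * (b k * (y + b k)⁻¹)) *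
          (abelE b (x + b j) U * abelE b (y + b k) V))]
    refine Finset.sum_congr rfl fun k _ => ?_
    rw [← Finset.mul_sum, sum_abelE_mul_abelE hb _ (add_pos hx (hb j)) (add_pos hy (hb k))]
    congr 2; ring

/-- The convolution of `abelD`, with the total `n = x + y + ∑ b` factored out. -/
theorem sum_abelD_mul_abelD' {b : ι → ℚ} (hb : ∀ i, 0 < b i) (S : Finset ι) {x y n : ℚ}
    (hx : 0 < x) (hy : 0 < y) (hn : n = x + y + ∑ i ∈ S, b i) :
    ∑ U ∈ S.powerset, abelD b x U * abelD b y (S \ U) = n ^ ((S.card : ℤ) - 3) * (x⁻¹ * y⁻¹ *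
      (n ^ 2 * (x⁻¹ * y⁻¹ * (x + y))
      - n * (∑ j ∈ S, b j * (x + y + b j) * (y⁻¹ * (x + b j)⁻¹)
          + ∑ j ∈ S, b j * (x + y + b j) * (x⁻¹ * (y + b j)⁻¹))
      + ∑ j ∈ S, ∑ k ∈ S.erase j,
          b j * b k * ((x + y + b j + b k) * ((x + b j)⁻¹ * (y + b k)⁻¹)))) := by
  have hn0 : n ≠ 0 := by rw [hn]; exact base_ne_zero hb (add_pos hx hy) S
  rw [sum_abelD_mul_abelD hb S hx hy]
  have h1 : abelE b (x + y) S = (x + y) * (n ^ ((S.card : ℤ) - 3) * n ^ 2) := by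
    rw [abelE, ← hn, ← zpow_natCast n 2, ← zpow_add₀ hn0]; congr 2; push_cast; ring
  have h2 : ∀ j ∈ S, abelE b (x + y + b j) (S.erase j) =
      (x + y + b j) * (n ^ ((S.card : ℤ) - 3) * n) := by
    intro j hj
    rw [abelE, add_assoc _ (b j), Finset.add_sum_erase _ _ hj, ← hn, ← zpow_add_one₀ hn0,
      Finset.card_erase_of_mem hj, Nat.cast_sub (Finset.card_pos.2 ⟨j, hj⟩)]
    congr 2; push_cast; ring
  have h3 : ∀ j ∈ S, ∀ k ∈ S.erase j, abelE b (x + y + b j + b k) ((S.erase j).erase k) =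
      (x + y + b j + b k) * n ^ ((S.card : ℤ) - 3) := by
    intro j hj k hk
    have c2 : 1 < S.card := by
      have := Finset.card_pos.2 ⟨k, hk⟩
      rw [Finset.card_erase_of_mem hj] at this; omega
    have hs : x + y + b j + b k + ∑ i ∈ (S.erase j).erase k, b i = n := by
      rw [add_assoc _ (b k), Finset.add_sum_erase _ _ hk, add_assoc _ (b j),
        Finset.add_sum_erase _ _ hj, ← hn]
    rw [abelE, hs, Finset.card_erase_of_mem hk,
      Finset.card_erase_of_mem hj]
    congr 2
    omega
  rw [h1, Finset.sum_congr rfl fun j hj => by rw [h2 j hj],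
    Finset.sum_congr (s₁ := S) (f := fun j => y⁻¹ * (b j * (y + b j)⁻¹) * (x⁻¹ * x⁻¹) * _) rfl
      fun j hj => by rw [h2 j hj],
    Finset.sum_congr (s₁ := S) (f := fun j => ∑ k ∈ S.erase j, _) rfl
      fun j hj => Finset.sum_congr rfl fun k hk => by rw [h3 j hj k hk]]
  simp only [mul_add, mul_sub, Finset.mul_sum]
  rw [← sub_sub]
  congr 1; congr 1; congr 1
  · ring
  · exact Finset.sum_congr rfl fun j _ => by ring
  · exact Finset.sum_congr rfl fun j _ => by ring
  · exact Finset.sum_congr rfl fun j _ => Finset.sum_congr rfl fun k _ => by ring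

end Abel

/-- `k ^ k / k!`. -/
def treeV (k : ℕ) : ℚ := (k : ℚ) ^ k / k.factorial

/-- `k ^ (k - 1) / k!`, the coefficients of the tree function. -/
def treeU (k : ℕ) : ℚ := treeV k / k

@[simp] theorem treeV_zero : treeV 0 = 1 := by simp [treeV]

@[simp] theorem treeU_zero : treeU 0 = 0 := by simp [treeU]

theorem treeV_pos (k : ℕ) : 0 < treeV k := by
  rcases Nat.eq_zero_or_pos k with rfl | h
  · simp
  · unfold treeV; positivity

theorem mul_treeU {k : ℕ} (hk : k ≠ 0) : (k : ℚ) * treeU k = treeV k := by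
  rw [treeU]; field_simp

theorem sum_treeV_mul_treeU {a : ℕ} (ha : a ≠ 0) :
    ∑ p ∈ antidiagonal a, treeU p.1 * treeV p.2 = treeV a := by
  obtain ⟨m, rfl⟩ := Nat.exists_eq_succ_of_ne_zero ha
  have key := sum_abelE_mul_abelF (b := fun _ : ℕ => (1 : ℚ)) (fun _ => one_pos) (range m)
    (x := 1) one_pos 0
  have h1 : ∀ U ∈ (range m).powerset, abelE (fun _ => (1 : ℚ)) 1 U *
      abelF (fun _ => (1 : ℚ)) 0 (range m \ U) =
      (1 + (U.card : ℚ)) ^ ((U.card : ℤ) - 1) * ((m - U.card : ℕ) : ℚ) ^ (m - U.card) := by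
    intro U hU
    have := Finset.card_sdiff_of_subset (Finset.mem_powerset.1 hU)
    rw [Finset.card_range] at this
    simp [abelE, abelF, this]
  rw [Finset.sum_congr rfl h1, Finset.sum_powerset_apply_card
    (fun k => (1 + (k : ℚ)) ^ ((k : ℤ) - 1) * ((m - k : ℕ) : ℚ) ^ (m - k)), Finset.card_range,
    ← Finset.Nat.sum_antidiagonal_eq_sum_range_succ_mk
      (fun p => m.choose p.1 • ((1 + (p.1 : ℚ)) ^ ((p.1 : ℤ) - 1) * ((m - p.1 : ℕ) : ℚ) ^ (m - p.1)))]
    at key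
  rw [Finset.Nat.antidiagonal_succ, Finset.sum_cons, treeU_zero, zero_mul, zero_add,
    Finset.sum_map]
  have h2 : ∀ p ∈ antidiagonal m, treeU (p.1 + 1) * treeV p.2 = (m.factorial : ℚ)⁻¹ *
      (m.choose p.1 • ((1 + (p.1 : ℚ)) ^ ((p.1 : ℤ) - 1) * ((m - p.1 : ℕ) : ℚ) ^ (m - p.1))) := by
    rintro ⟨i, j⟩ hp
    rw [HasAntidiagonal.mem_antidiagonal] at hp
    subst hp
    have hf := Nat.add_choose_mul_factorial_mul_factorial i j
    have hc : ((i + j).choose i : ℚ) = (i + j).factorial / (i.factorial * j.factorial) := by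
      rw [eq_div_iff (by positivity), ← hf, Nat.choose_symm_add]; push_cast; ring
    have h0 : (1 + (i : ℚ)) ≠ 0 := by positivity
    simp only [treeU, treeV, nsmul_eq_mul, Nat.add_sub_cancel_left, Nat.factorial_succ]
    rw [hc, zpow_sub_one₀ h0, zpow_natCast]
    push_cast
    rw [add_comm (i : ℚ) 1]
    field_simp
    ring
  refine (Finset.sum_congr rfl fun p hp => h2 p hp).trans ?_
  rw [← Finset.mul_sum, key]
  simp only [abelF, treeV, Nat.factorial_succ]
  simp
  rw [add_comm (1 : ℚ)]
  field_simp
  ring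

section Bivariate

open PowerSeries

/-- Formal power series in `x` (inner variable) and `y` (outer variable). -/
abbrev Ser := PowerSeries (PowerSeries ℚ)

/-- The Euler operator `x ∂/∂x + y ∂/∂y`. -/
noncomputable def euler (f : Ser) : Ser :=
  mk fun b => mk fun a => ((a : ℚ) + b) * coeff a (coeff b f)

/-- The series with coefficients `c a b`. -/
noncomputable def ser (c : ℕ → ℕ → ℚ) : Ser := mk fun b => mk fun a => c a b

@[simp] theorem coeff_ser (c : ℕ → ℕ → ℚ) (a b : ℕ) : coeff a (coeff b (ser c)) = c a b := by
  simp [ser]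

@[simp] theorem coeff_euler (f : Ser) (a b : ℕ) :
    coeff a (coeff b (euler f)) = ((a : ℚ) + b) * coeff a (coeff b f) := by
  simp [euler]

theorem ser_ext {f g : Ser} (h : ∀ a b, coeff a (coeff b f) = coeff a (coeff b g)) : f = g := by
  ext b a; exact h a b

theorem coeff_coeff_mul (f g : Ser) (a b : ℕ) : coeff a (coeff b (f * g)) =
    ∑ j ∈ antidiagonal b, ∑ i ∈ antidiagonal a,
      coeff i.1 (coeff j.1 f) * coeff i.2 (coeff j.2 g) := by
  simp [coeff_mul, map_sum]

theorem euler_mul (f g : Ser) : euler (f * g) = euler f * g + f * euler g := by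
  refine ser_ext fun a b => ?_
  simp only [coeff_euler, map_add, coeff_coeff_mul, Finset.mul_sum, ← Finset.sum_add_distrib]
  refine Finset.sum_congr rfl fun j hj => Finset.sum_congr rfl fun i hi => ?_
  rw [HasAntidiagonal.mem_antidiagonal] at hi hj
  rw [← hi, ← hj]; push_cast; ring

theorem euler_add (f g : Ser) : euler (f + g) = euler f + euler g := by
  refine ser_ext fun a b => ?_
  simp [mul_add]

theorem euler_sub (f g : Ser) : euler (f - g) = euler f - euler g := by
  refine ser_ext fun a b => ?_
  simp [mul_sub]

theorem euler_one : euler 1 = 0 := by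
  refine ser_ext fun a b => ?_
  simp only [coeff_euler, coeff_one]
  split_ifs with h <;> simp [coeff_one, h]

/-- Series in `x` only. -/
noncomputable def serX (c : ℕ → ℚ) : Ser := PowerSeries.C (mk c)

/-- Series in `y` only. -/
noncomputable def serY (c : ℕ → ℚ) : Ser := mk fun b => PowerSeries.C (c b)

theorem coeff_serX_mul (c : ℕ → ℚ) (f : Ser) (a b : ℕ) : coeff a (coeff b (serX c * f)) =
    ∑ i ∈ antidiagonal a, c i.1 * coeff i.2 (coeff b f) := by
  simp only [serX, PowerSeries.coeff_C_mul]; simp [coeff_mul]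

theorem coeff_serY_mul (c : ℕ → ℚ) (f : Ser) (a b : ℕ) : coeff a (coeff b (serY c * f)) =
    ∑ j ∈ antidiagonal b, c j.1 * coeff a (coeff j.2 f) := by
  rw [coeff_mul, map_sum]; simp only [serY, coeff_mk, PowerSeries.coeff_C_mul]

theorem coeff_serX (c : ℕ → ℚ) (a b : ℕ) :
    coeff a (coeff b (serX c)) = if b = 0 then c a else 0 := by
  simp only [serX, coeff_C]; split_ifs <;> simp

theorem coeff_serY (c : ℕ → ℚ) (a b : ℕ) :
    coeff a (coeff b (serY c)) = if a = 0 then c b else 0 := by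
  simp [serY, coeff_C]

theorem coeff_serX_mul_serY (c d : ℕ → ℚ) (a b : ℕ) :
    coeff a (coeff b (serX c * serY d)) = c a * d b := by
  rw [mul_comm, coeff_serY_mul, Finset.sum_eq_single (b, 0)]
  · rw [coeff_serX, if_pos rfl, mul_comm]
  · rintro ⟨i, j⟩ h h'
    simp only [HasAntidiagonal.mem_antidiagonal] at h
    have : j ≠ 0 := by rintro rfl; simp at h; simp [h] at h'
    simp [coeff_serX, this]
  · simp

theorem euler_serX (c : ℕ → ℚ) : euler (serX c) = serX fun a => a * c a := by
  refine ser_ext fun a b => ?_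
  simp only [coeff_euler, coeff_serX]
  split_ifs with h <;> simp [h]

theorem euler_serY (c : ℕ → ℚ) : euler (serY c) = serY fun a => a * c a := by
  refine ser_ext fun a b => ?_
  simp only [coeff_euler, coeff_serY]
  split_ifs with h <;> simp [h]

theorem mk_treeV : (mk treeV : PowerSeries ℚ) = 1 + mk treeU * mk treeV := by
  ext a
  rcases Nat.eq_zero_or_pos a with rfl | h
  · simp
  · simp [coeff_mul, coeff_one, h.ne', sum_treeV_mul_treeU h.ne']

theorem serX_treeV : serX treeV = 1 + serX treeU * serX treeV := by
  simp only [serX]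
  conv_lhs => rw [mk_treeV]
  simp

theorem serY_treeV : serY treeV = 1 + serY treeU * serY treeV := by
  refine ser_ext fun a b => ?_
  rw [map_add, map_add, coeff_serY_mul]
  rcases Nat.eq_zero_or_pos b with rfl | h
  · by_cases ha : a = 0 <;> rw [coeff_serY] <;> simp [coeff_one, ha]
  · by_cases ha : a = 0
    · simp [coeff_serY, coeff_one, h.ne', sum_treeV_mul_treeU h.ne', ha]
    · simp [coeff_serY, coeff_one, h.ne', ha]

theorem natCast_mul_treeU : (fun a : ℕ => (a : ℚ) * treeU a) = fun a => treeV a - if a = 0 then 1 else 0 := by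
  funext a
  split_ifs with h
  · simp [h]
  · simp [mul_treeU h]

theorem euler_serX_treeU : euler (serX treeU) = serX treeU * serX treeV := by
  rw [euler_serX, natCast_mul_treeU, ← sub_eq_iff_eq_add'.2 serX_treeV]
  refine ser_ext fun a b => ?_
  rw [map_sub, map_sub, coeff_serX, coeff_serX, coeff_one]
  split_ifs <;> simp_all [coeff_one]

theorem euler_serY_treeU : euler (serY treeU) = serY treeU * serY treeV := by
  rw [euler_serY, natCast_mul_treeU, ← sub_eq_iff_eq_add'.2 serY_treeV]
  refine ser_ext fun a b => ?_
  rw [map_sub, map_sub, coeff_serY, coeff_serY, coeff_one]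
  split_ifs <;> simp_all [coeff_one]

/-- From `V = 1 + U V` and `θ U = U V` it follows that `θ V = U V ^ 3`. -/
theorem euler_of_eq {U V : Ser} (h : V = 1 + U * V) (hU : euler U = U * V) :
    euler V = U * V ^ 3 := by
  have h1 : euler V = U * V * V + U * euler V := by
    conv_lhs => rw [h, euler_add, euler_one, euler_mul, hU, zero_add]
  have h2 : (1 - U) * V = 1 := by linear_combination h
  linear_combination V * h1 - euler V * h2

theorem coeff_X_inner_mul (f : Ser) (a b : ℕ) :
    coeff a (coeff b ((PowerSeries.C PowerSeries.X : Ser) * f)) =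
      if a = 0 then 0 else coeff (a - 1) (coeff b f) := by
  rw [PowerSeries.coeff_C_mul]
  cases a <;> simp [coeff_succ_X_mul]

theorem coeff_X_outer_mul (f : Ser) (a b : ℕ) :
    coeff a (coeff b ((PowerSeries.X : Ser) * f)) =
      if b = 0 then 0 else coeff a (coeff (b - 1) f) := by
  cases b <;> simp [coeff_succ_X_mul]

theorem coeff_coeff_one (a b : ℕ) :
    coeff a (coeff b (1 : Ser)) = if a = 0 ∧ b = 0 then 1 else 0 := by
  rw [coeff_one]
  split_ifs <;> simp_all [coeff_one]

theorem euler_X_inner : euler (PowerSeries.C PowerSeries.X : Ser) = PowerSeries.C PowerSeries.X := by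
  refine ser_ext fun a b => ?_
  have h := coeff_X_inner_mul 1 a b
  rw [mul_one, coeff_coeff_one] at h
  rw [coeff_euler, h]
  split_ifs with h1 h2
  · simp
  · obtain ⟨h2, rfl⟩ := h2
    obtain rfl : a = 1 := by omega
    norm_num
  · simp

theorem euler_X_outer : euler (PowerSeries.X : Ser) = PowerSeries.X := by
  refine ser_ext fun a b => ?_
  have h := coeff_X_outer_mul 1 a b
  rw [mul_one, coeff_coeff_one] at h
  rw [coeff_euler, h]
  split_ifs with h1 h2
  · simp
  · obtain ⟨rfl, h2⟩ := h2
    obtain rfl : b = 1 := by omega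
    norm_num
  · simp

noncomputable def serN : Ser := ser fun a b => treeV a * (b * treeV b) / (a + b)

noncomputable def serN' : Ser := ser fun a b => treeV b * (a * treeV a) / (a + b)

noncomputable def serK : Ser := ser fun a b => if a = 0 ∨ b = 0 then 0 else treeU (a + b)

theorem cast_add_cast_ne_zero {a b : ℕ} (h : a ≠ 0 ∨ b ≠ 0) : (a : ℚ) + b ≠ 0 := by
  have : a + b ≠ 0 := by omega
  exact_mod_cast this

theorem euler_serN : euler serN = serX treeV * euler (serY treeV) := by
  refine ser_ext fun a b => ?_
  rw [euler_serY, coeff_serX_mul_serY, coeff_euler, serN, coeff_ser]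
  by_cases h : a ≠ 0 ∨ b ≠ 0
  · have := cast_add_cast_ne_zero h
    field_simp
  · push Not at h
    simp [h.1, h.2]

theorem euler_serN' : euler serN' = serY treeV * euler (serX treeV) := by
  refine ser_ext fun a b => ?_
  rw [euler_serX, mul_comm, coeff_serX_mul_serY, coeff_euler, serN', coeff_ser]
  by_cases h : a ≠ 0 ∨ b ≠ 0
  · have := cast_add_cast_ne_zero h
    field_simp
  · push Not at h
    simp [h.1, h.2]

theorem serN_add_serN' : serN + serN' = serX treeV * serY treeV - 1 := by
  refine ser_ext fun a b => ?_
  rw [map_add, map_add, map_sub, map_sub, coeff_serX_mul_serY, serN, serN', coeff_ser, coeff_ser,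
    coeff_coeff_one]
  by_cases h : a ≠ 0 ∨ b ≠ 0
  · have := cast_add_cast_ne_zero h
    rw [if_neg (by omega)]
    field_simp
    ring
  · push Not at h
    simp [h.1, h.2]

theorem sub_mul_serK : ((PowerSeries.C PowerSeries.X : Ser) - PowerSeries.X) * serK =
    PowerSeries.X * serX treeU - (PowerSeries.C PowerSeries.X : Ser) * serY treeU := by
  refine ser_ext fun a b => ?_
  rw [sub_mul, map_sub, map_sub, map_sub, map_sub, coeff_X_inner_mul, coeff_X_inner_mul,
    coeff_X_outer_mul, coeff_X_outer_mul, serK, coeff_ser, coeff_ser, coeff_serX, coeff_serY]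
  rcases a with _ | _ | a <;> rcases b with _ | _ | b <;>
    simp [add_assoc, add_comm, add_left_comm]

theorem serX_mul_serN_add_serY_mul_serN' : serX treeU * serN + serY treeU * serN' =
    serK + (serX treeV - 1) * (serY treeV - 1) := by
  have hX := serX_treeV
  have hY := serY_treeV
  have eVX := euler_of_eq serX_treeV euler_serX_treeU
  have eVY := euler_of_eq serY_treeV euler_serY_treeU
  set A := serX treeU
  set B := serY treeU
  set V := serX treeV
  set W := serY treeV
  set x : Ser := PowerSeries.C PowerSeries.X
  set y : Ser := PowerSeries.X
  have hne : x - y ≠ 0 := by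
    intro h
    have h1 := coeff_X_inner_mul 1 1 0
    have h2 := coeff_X_outer_mul 1 1 0
    rw [mul_one, coeff_coeff_one] at h1 h2
    rw [sub_eq_zero] at h
    change coeff 1 (coeff 0 x) = _ at h1
    change coeff 1 (coeff 0 y) = _ at h2
    rw [h, h2] at h1
    simp at h1
  have eK : euler serK = V * W * (serK + A * B) := by
    have h := congrArg euler sub_mul_serK
    rw [euler_mul, euler_sub, euler_sub, euler_mul, euler_mul, euler_X_inner, euler_X_outer,
      euler_serX_treeU, euler_serY_treeU] at h
    apply mul_left_cancel₀ hne
    have hK := sub_mul_serK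
    change (x - y) * serK = y * A - x * B at hK
    change (x - y) * serK + (x - y) * euler serK = y * A + y * (A * V) - (x * B + x * (B * W)) at h
    linear_combination h - hK - V * W * hK - y * A * V * hY + x * B * W * hX
  have eZ : euler (A * serN + B * serN' - (serK + (V - 1) * (W - 1))) =
      V * W * (A * serN + B * serN' - (serK + (V - 1) * (W - 1))) := by
    rw [euler_sub, euler_add, euler_add, euler_mul, euler_mul, euler_mul, euler_sub, euler_sub,
      euler_one, euler_serN, euler_serN', eVX, eVY, eK, euler_serX_treeU, euler_serY_treeU]
    change A * V * serN + A * (V * (B * W ^ 3)) + (B * W * serN' + B * (W * (A * V ^ 3))) -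
      (V * W * (serK + A * B) + ((A * V ^ 3 - 0) * (W - 1) + (V - 1) * (B * W ^ 3 - 0))) = _
    have hN : serN + serN' = V * W - 1 := serN_add_serN'
    have hA : A * V = V - 1 := by linear_combination -hX
    have hB : B * W = W - 1 := by linear_combination -hY
    linear_combination (A * V ^ 3 + A * V * serN - A * V ^ 2 * W) * hB +
      (B * W ^ 3 + B * W * serN' - V * W * (W - 1)) * hA - A * B * V * W * hN
  have hZ : ∀ n a b, a + b = n → coeff a (coeff b
      (A * serN + B * serN' - (serK + (V - 1) * (W - 1)))) = 0 := by
    intro n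
    induction n using Nat.strong_induction_on with
    | _ n ih =>
      intro a b hab
      by_cases h0 : a = 0 ∨ b = 0
      · have e : (V - 1) * (W - 1) = V * W - V - W + 1 := by ring
        rw [e]
        simp only [map_sub, map_add, coeff_coeff_one]
        rw [coeff_serX_mul_serY, coeff_serX, coeff_serY, coeff_serX_mul, coeff_serY_mul, serK,
          coeff_ser, if_pos h0]
        have hN0 : ∀ i, coeff i (coeff 0 serN) = 0 := fun i => by simp [serN, -coeff_zero_eq_constantCoeff]
        have hN0' : ∀ j, coeff 0 (coeff j serN') = 0 := fun i => by simp [serN', -coeff_zero_eq_constantCoeff]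
        rcases h0 with rfl | rfl
        · simp [-coeff_zero_eq_constantCoeff, hN0']
        · simp [-coeff_zero_eq_constantCoeff, hN0]
      · have h := congrArg (fun f => coeff a (coeff b f)) eZ
        simp only [coeff_euler] at h
        rw [coeff_coeff_mul, Finset.sum_eq_single (0, b), Finset.sum_eq_single (0, a)] at h
        · rw [coeff_serX_mul_serY] at h
          have h1 : (a : ℚ) + b - 1 ≠ 0 := by
            have : (2 : ℚ) ≤ a + b := by
              have : 2 ≤ a + b := by omega
              exact_mod_cast this
            intro h; linarith
          apply mul_left_cancel₀ h1
          simp only [treeV_zero] at h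
          linear_combination h
        · rintro ⟨i, j⟩ h1 h2
          rw [HasAntidiagonal.mem_antidiagonal] at h1
          rw [ih (j + b) _ _ _ rfl, mul_zero]
          have : i ≠ 0 := by rintro rfl; simp at h1; simp [h1] at h2
          simp at h1
          omega
        · simp
        · rintro ⟨i, j⟩ h1 h2
          rw [HasAntidiagonal.mem_antidiagonal] at h1
          apply Finset.sum_eq_zero
          rintro ⟨k, l⟩ h3
          rw [HasAntidiagonal.mem_antidiagonal] at h3
          rw [ih (l + j) _ _ _ rfl, mul_zero]
          have : i ≠ 0 := by rintro rfl; simp at h1; simp [h1] at h2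
          simp at h1 h3
          omega
        · simp
  exact sub_eq_zero.1 (ser_ext fun a b => by rw [hZ _ a b rfl]; simp)

theorem sum_treeU_symm {a b : ℕ} (ha : a ≠ 0) (hb : b ≠ 0) :
    b * treeV b * ∑ p ∈ antidiagonal a, treeU p.1 * treeV p.2 / (p.2 + b) +
      a * treeV a * ∑ p ∈ antidiagonal b, treeU p.1 * treeV p.2 / (p.2 + a) =
    treeU (a + b) + treeV a * treeV b := by
  have h := congrArg (fun f => coeff a (coeff b f)) serX_mul_serN_add_serY_mul_serN'
  have e : (serX treeV - 1) * (serY treeV - 1) =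
    serX treeV * serY treeV - serX treeV - serY treeV + 1 := by ring
  simp only [e, map_add, map_sub] at h
  rw [coeff_serX_mul_serY] at h
  simp only [coeff_serX_mul, coeff_serY_mul, coeff_serX,
    coeff_serY, coeff_coeff_one, serK, serN, serN', coeff_ser, ha, hb, or_self, if_false,
    false_and] at h
  rw [sub_zero, sub_zero, add_zero] at h
  rw [← h, Finset.mul_sum, Finset.mul_sum]
  congr 1
  · exact Finset.sum_congr rfl fun p _ => by ring
  · exact Finset.sum_congr rfl fun p _ => by ring

end Bivariate

/-- Pairs of positive integers with sum `a`. -/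
def interior (a : ℕ) : Finset (ℕ × ℕ) := ((antidiagonal a).erase (0, a)).erase (a, 0)

theorem mem_interior {a : ℕ} {p : ℕ × ℕ} :
    p ∈ interior a ↔ p.1 + p.2 = a ∧ p.1 ≠ 0 ∧ p.2 ≠ 0 := by
  obtain ⟨i, j⟩ := p
  simp only [interior, mem_erase, HasAntidiagonal.mem_antidiagonal, ne_eq, Prod.mk.injEq]
  omega

theorem sum_antidiagonal_eq_interior {a : ℕ} (ha : a ≠ 0) (f : ℕ × ℕ → ℚ) :
    ∑ p ∈ antidiagonal a, f p = f (0, a) + f (a, 0) + ∑ p ∈ interior a, f p := by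
  rw [interior, ← Finset.add_sum_erase (antidiagonal a) f (a := (0, a)) (by simp),
    ← Finset.add_sum_erase ((antidiagonal a).erase (0, a)) f (a := (a, 0)) (by simp [ha]),
    add_assoc]

theorem sum_interior_swap (a : ℕ) (f : ℕ → ℕ → ℚ) :
    ∑ p ∈ interior a, f p.2 p.1 = ∑ p ∈ interior a, f p.1 p.2 := by
  refine Finset.sum_bij' (fun p _ => p.swap) (fun p _ => p.swap) ?_ ?_ ?_ ?_ ?_ <;>
    simp [mem_interior] <;> omega

/-- `∑_{p + q = a, p, q ≥ 1} U_p V_q / (q + b)`. -/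
def treeG (a b : ℕ) : ℚ := ∑ p ∈ interior a, treeU p.1 * treeV p.2 / (p.2 + b)

theorem treeG_symm {a b : ℕ} (ha : a ≠ 0) (hb : b ≠ 0) :
    b * treeV b * treeG a b + a * treeV a * treeG b a =
      treeU (a + b) + treeV a * treeV b - treeU a * treeV b - treeU b * treeV a := by
  have h := sum_treeU_symm ha hb
  rw [sum_antidiagonal_eq_interior ha, sum_antidiagonal_eq_interior hb] at h
  simp only [treeU_zero, treeV_zero, zero_mul, zero_div, zero_add, mul_one, Nat.cast_zero] at h
  rw [← h, treeG, treeG]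
  have : (a : ℚ) ≠ 0 := by exact_mod_cast ha
  have : (b : ℚ) ≠ 0 := by exact_mod_cast hb
  field_simp
  ring

theorem sum_interior_treeU_mul_treeV {a : ℕ} (ha : a ≠ 0) :
    ∑ p ∈ interior a, treeU p.1 * treeV p.2 = treeV a - treeU a := by
  rw [← sum_treeV_mul_treeU ha, sum_antidiagonal_eq_interior ha]
  simp

theorem sum_interior_treeV_mul_treeV {a : ℕ} (ha : a ≠ 0) (b : ℕ) :
    ∑ p ∈ interior a, treeV p.1 * treeV p.2 / (p.2 + b) =
      (a + b) * treeG a b - (treeV a - treeU a) := by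
  rw [← sum_interior_treeU_mul_treeV ha, treeG, Finset.mul_sum, ← Finset.sum_sub_distrib]
  refine Finset.sum_congr rfl fun p hp => ?_
  obtain ⟨h, h1, h2⟩ := mem_interior.1 hp
  have e1 : (p.1 : ℚ) ≠ 0 := by exact_mod_cast h1
  have e2 : (p.2 : ℚ) + b ≠ 0 := cast_add_cast_ne_zero (Or.inl h2)
  rw [← h, treeU]
  push_cast
  field_simp
  ring

theorem sum_sum_erase_comm {ι : Type*} [DecidableEq ι] (P : Finset ι) (f : ι → ι → ℚ) :
    ∑ i ∈ P, ∑ j ∈ P.erase i, f i j = ∑ i ∈ P, ∑ j ∈ P.erase i, f j i := by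
  refine Finset.sum_comm' ?_
  intro x y
  simp only [mem_erase]
  tauto

/-- The weight `k ^ k / (k - 1)!` of a cycle of length `k`. -/
def weight (k : ℕ) : ℚ := k * treeV k

theorem weight_ne_zero {k : ℕ} (hk : k ≠ 0) : weight k ≠ 0 := by
  have := treeV_pos k
  have : (k : ℚ) ≠ 0 := by exact_mod_cast hk
  unfold weight; positivity

section

variable {ι : Type*} [DecidableEq ι] {c : ι → ℕ}

theorem sum_cut (hc : ∀ i, c i ≠ 0) (S : Finset ι) {a n : ℕ} (ha : a ≠ 0)
    (hn : n = a + ∑ i ∈ S, c i) :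
    ∑ p ∈ antidiagonal a, weight p.1 * weight p.2 *
      ∑ T ∈ S.powerset, abelD (fun i => (c i : ℚ)) p.1 T * abelD (fun i => (c i : ℚ)) p.2 (S \ T) =
    (n : ℚ) ^ ((S.card : ℤ) - 3) * (2 * (treeV a - treeU a) *
      (n ^ 2 - ∑ j ∈ S, (c j : ℚ) * (n - a - c j)) -
        2 * ∑ j ∈ S, (c j : ℚ) * (a + c j) ^ 2 * treeG a (c j)) := by
  rw [sum_antidiagonal_eq_interior ha]
  have hb : ∀ i, 0 < (c i : ℚ) := fun i => by exact_mod_cast Nat.pos_of_ne_zero (hc i)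
  have hn' : (n : ℚ) = a + ∑ i ∈ S, (c i : ℚ) := by rw [hn]; push_cast; rfl
  have h : ∀ p ∈ interior a, weight p.1 * weight p.2 *
      ∑ T ∈ S.powerset, abelD (fun i => (c i : ℚ)) p.1 T * abelD (fun i => (c i : ℚ)) p.2 (S \ T) =
      (n : ℚ) ^ ((S.card : ℤ) - 3) * (
        n ^ 2 * (treeU p.1 * treeV p.2 + treeU p.2 * treeV p.1)
        - n * (∑ j ∈ S, (c j : ℚ) * (a + c j) * (treeU p.2 * treeV p.1 / (p.1 + c j))
          + ∑ j ∈ S, (c j : ℚ) * (a + c j) * (treeU p.1 * treeV p.2 / (p.2 + c j)))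
        + ∑ j ∈ S, ∑ k ∈ S.erase j, (c j : ℚ) * c k *
            (treeV p.2 * treeV p.1 / (p.1 + c j) + treeV p.1 * treeV p.2 / (p.2 + c k))) := by
    intro p hp
    obtain ⟨h, h1, h2⟩ := mem_interior.1 hp
    have e1 : (p.1 : ℚ) ≠ 0 := by exact_mod_cast h1
    have e2 : (p.2 : ℚ) ≠ 0 := by exact_mod_cast h2
    have h' : (p.1 : ℚ) + p.2 = a := by rw [← h]; push_cast; rfl
    rw [sum_abelD_mul_abelD' hb S (x := p.1) (y := p.2) (n := n) (by positivity) (by positivity)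
      (by rw [hn', ← h']), h', mul_left_comm]
    congr 1
    rw [← mul_assoc, show weight p.1 * weight p.2 * ((p.1 : ℚ)⁻¹ * (p.2 : ℚ)⁻¹) =
      treeV p.1 * treeV p.2 by unfold weight; field_simp]
    rw [mul_add, mul_sub]
    congr 1
    · congr 1
      · rw [← h', treeU, treeU]; field_simp; ring
      · rw [mul_left_comm, mul_add, Finset.mul_sum, Finset.mul_sum]
        congr 2
        · refine Finset.sum_congr rfl fun j _ => ?_
          rw [treeU]; have := hb j; field_simp
        · refine Finset.sum_congr rfl fun j _ => ?_
          rw [treeU]; have := hb j; field_simp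
    · rw [Finset.mul_sum]
      refine Finset.sum_congr rfl fun j _ => ?_
      rw [Finset.mul_sum]
      refine Finset.sum_congr rfl fun k _ => ?_
      have := hb j
      have := hb k
      rw [← h']
      field_simp
      ring
  rw [Finset.sum_congr rfl h, ← Finset.mul_sum]
  have z : weight 0 = 0 := by simp [weight]
  rw [z, zero_mul, zero_mul, mul_zero, zero_mul, zero_add, zero_add]
  congr 1
  rw [Finset.sum_add_distrib, Finset.sum_sub_distrib, ← Finset.mul_sum, ← Finset.mul_sum,
    Finset.sum_add_distrib, Finset.sum_add_distrib,
    sum_interior_swap a (fun i j => treeU i * treeV j), sum_interior_treeU_mul_treeV ha,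
    sum_interior_swap a (fun i j => ∑ x ∈ S, (c x : ℚ) * (a + c x) * (treeU i * treeV j / (j + c x))),
    Finset.sum_comm]
  have h2 : ∀ j ∈ S, ∑ p ∈ interior a, (c j : ℚ) * (a + c j) * (treeU p.1 * treeV p.2 / (p.2 + c j)) =
      (c j : ℚ) * (a + c j) * treeG a (c j) := fun j _ => by rw [treeG, Finset.mul_sum]
  rw [Finset.sum_congr rfl h2, Finset.sum_comm]
  have h3 : ∀ j ∈ S, ∑ p ∈ interior a, ∑ k ∈ S.erase j, (c j : ℚ) * c k *
      (treeV p.2 * treeV p.1 / (p.1 + c j) + treeV p.1 * treeV p.2 / (p.2 + c k)) =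
      ∑ k ∈ S.erase j, (c j : ℚ) * c k * ((a + c j) * treeG a (c j) - (treeV a - treeU a)) +
      ∑ k ∈ S.erase j, (c k : ℚ) * c j * ((a + c k) * treeG a (c k) - (treeV a - treeU a)) := by
    intro j _
    rw [Finset.sum_comm, ← Finset.sum_add_distrib]
    refine Finset.sum_congr rfl fun k _ => ?_
    rw [← Finset.mul_sum, Finset.sum_add_distrib,
      sum_interior_swap a (fun i l => treeV i * treeV l / (l + c j)),
      sum_interior_treeV_mul_treeV ha, sum_interior_treeV_mul_treeV ha]
    ring
  rw [Finset.sum_congr rfl h3, Finset.sum_add_distrib,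
    ← sum_sum_erase_comm S (fun j k =>
      (c j : ℚ) * c k * ((a + c j) * treeG a (c j) - (treeV a - treeU a)))]
  have h4 : ∀ j ∈ S, ∑ k ∈ S.erase j, (c j : ℚ) * c k *
      ((a + c j) * treeG a (c j) - (treeV a - treeU a)) =
      (c j : ℚ) * (n - a - c j) * ((a + c j) * treeG a (c j) - (treeV a - treeU a)) := by
    intro j hj
    rw [← Finset.sum_mul, ← Finset.mul_sum, hn', ← Finset.add_sum_erase _ _ hj]
    ring
  rw [Finset.sum_congr rfl h4]
  have h5 : ∑ j ∈ S, (c j : ℚ) * (n - a - c j) * ((a + c j) * treeG a (c j) - (treeV a - treeU a)) =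
      n * ∑ j ∈ S, (c j : ℚ) * (a + c j) * treeG a (c j) -
      ∑ j ∈ S, (c j : ℚ) * (a + c j) ^ 2 * treeG a (c j) -
      (treeV a - treeU a) * ∑ j ∈ S, (c j : ℚ) * (n - a - c j) := by
    rw [Finset.mul_sum, Finset.mul_sum, ← Finset.sum_sub_distrib, ← Finset.sum_sub_distrib]
    exact Finset.sum_congr rfl fun j _ => by ring
  rw [h5]
  ring

theorem sum_polynomial_identity (P : Finset ι) (x : ι → ℚ) (hx : ∀ i, x i ≠ 0) {n : ℚ}
    (hn : n = ∑ i ∈ P, x i) :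
    ∑ i ∈ P, 2 * (1 - 1 / x i) * (n ^ 2 - ∑ j ∈ P.erase i, x j * (n - x i - x j)) -
      ∑ i ∈ P, ∑ j ∈ P.erase i, (x i + x j) ^ 2 * (1 - 1 / x i - 1 / x j) =
    2 * (n + P.card - 2) * n := by
  have e : ∀ (f : ι → ℚ), ∀ i ∈ P, ∑ j ∈ P.erase i, f j = ∑ j ∈ P, f j - f i := fun f i hi => by
    rw [← Finset.add_sum_erase P f hi]; ring
  have h1 : ∀ i ∈ P, 2 * (1 - 1 / x i) * (n ^ 2 - ∑ j ∈ P.erase i, x j * (n - x i - x j)) =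
      2 * (2 * n * x i - 2 * x i ^ 2 + ∑ j ∈ P, x j ^ 2 - 2 * n + 2 * x i -
        (∑ j ∈ P, x j ^ 2) * (x i)⁻¹) := by
    intro i hi
    have : ∑ j ∈ P, x j * (n - x i - x j) = (n - x i) * n - ∑ j ∈ P, x j ^ 2 := by
      conv_rhs => rw [hn, Finset.mul_sum, ← hn, ← Finset.sum_sub_distrib]
      exact Finset.sum_congr rfl fun j _ => by ring
    rw [e _ i hi, this]
    have := hx i
    field_simp
    ring
  have h2 : ∀ i ∈ P, ∑ j ∈ P.erase i, (x i + x j) ^ 2 * (1 - 1 / x i - 1 / x j) =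
      P.card * x i ^ 2 + 2 * n * x i + ∑ j ∈ P, x j ^ 2 - 3 * P.card * x i - 3 * n
        - (∑ j ∈ P, x j ^ 2) * (x i)⁻¹ - (∑ j ∈ P, (x j)⁻¹) * x i ^ 2
        - 4 * x i ^ 2 + 8 * x i := by
    intro i hi
    have hxi := hx i
    have : ∑ j ∈ P, (x i + x j) ^ 2 * (1 - 1 / x i - 1 / x j) =
        P.card * x i ^ 2 + 2 * n * x i + ∑ j ∈ P, x j ^ 2 - 3 * P.card * x i - 3 * n
        - (∑ j ∈ P, x j ^ 2) * (x i)⁻¹ - (∑ j ∈ P, (x j)⁻¹) * x i ^ 2 := by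
      have h3 : ∀ j ∈ P, (x i + x j) ^ 2 * (1 - 1 / x i - 1 / x j) =
          (x i ^ 2 - 3 * x i) + (2 * x i - 3) * x j + (1 - (x i)⁻¹) * x j ^ 2
            - x i ^ 2 * (x j)⁻¹ := by
        intro j _
        have := hx j
        field_simp
        ring
      rw [Finset.sum_congr rfl h3, Finset.sum_sub_distrib, Finset.sum_add_distrib,
        Finset.sum_add_distrib, ← Finset.mul_sum, ← Finset.mul_sum, ← Finset.mul_sum, ← hn,
        Finset.sum_const, nsmul_eq_mul]
      ring
    rw [e _ i hi, this]
    field_simp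
    ring
  rw [Finset.sum_congr rfl h1, Finset.sum_congr rfl h2]
  simp only [Finset.sum_sub_distrib, Finset.sum_add_distrib, ← Finset.mul_sum, ← hn,
    Finset.sum_const, nsmul_eq_mul]
  ring

/-- The closed form of the cut-and-join recursion in genus `0`. -/
theorem cut_join_identity (hc : ∀ i, c i ≠ 0) (P : Finset ι) (hP : P.Nonempty) {n : ℕ}
    (hn : n = ∑ i ∈ P, c i) :
    ((n : ℚ) + P.card - 2) * ((n : ℚ) ^ ((P.card : ℤ) - 3) * ∏ i ∈ P, weight (c i)) =
      1 / 2 * (∑ i ∈ P, ∑ j ∈ P.erase i, (c i : ℚ) * c j * ((n : ℚ) ^ ((P.card : ℤ) - 4) *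
          (weight (c i + c j) * ∏ k ∈ (P.erase i).erase j, weight (c k))) +
        ∑ i ∈ P, (c i : ℚ) * ∑ p ∈ antidiagonal (c i), weight p.1 * weight p.2 *
          ∑ T ∈ (P.erase i).powerset,
            (abelD (fun i => (c i : ℚ)) p.1 T * ∏ k ∈ T, weight (c k)) *
            (abelD (fun i => (c i : ℚ)) p.2 (P.erase i \ T) *
              ∏ k ∈ P.erase i \ T, weight (c k))) := by
  have hx : ∀ i, (c i : ℚ) ≠ 0 := fun i => by exact_mod_cast hc i
  have hn' : (n : ℚ) = ∑ i ∈ P, (c i : ℚ) := by rw [hn]; push_cast; rfl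
  have hn0 : (n : ℚ) ≠ 0 := by
    obtain ⟨i, hi⟩ := hP
    have : 0 < n := by
      rw [hn]; exact Finset.sum_pos (fun i _ => Nat.pos_of_ne_zero (hc i)) ⟨i, hi⟩
    positivity
  have hv : ∀ k, treeV k ≠ 0 := fun k => (treeV_pos k).ne'
  have hw : ∀ i, weight (c i) ≠ 0 := fun i => weight_ne_zero (hc i)
  set W := ∏ i ∈ P, weight (c i) with hW
  set N := (n : ℚ) ^ ((P.card : ℤ) - 4) with hN
  have hNN : (n : ℚ) ^ ((P.card : ℤ) - 3) = N * n := by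
    rw [hN, ← zpow_add_one₀ hn0]; congr 1; ring
  have hjoin : ∀ i ∈ P, ∀ j ∈ P.erase i, (c i : ℚ) * c j * (N *
      (weight (c i + c j) * ∏ k ∈ (P.erase i).erase j, weight (c k))) = N * W *
      (((c i : ℚ) + c j) ^ 2 * treeU (c i + c j) / (treeV (c i) * treeV (c j))) := by
    intro i hi j hj
    rw [hW, ← Finset.mul_prod_erase P _ hi, ← Finset.mul_prod_erase (P.erase i) _ hj, weight,
      ← mul_treeU (k := c i + c j) (by have := hc i; omega), weight, weight]
    have := hv (c i)
    have := hv (c j)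
    push_cast
    field_simp
  have hcut : ∀ i ∈ P, (c i : ℚ) * ∑ p ∈ antidiagonal (c i), weight p.1 * weight p.2 *
          ∑ T ∈ (P.erase i).powerset,
            (abelD (fun i => (c i : ℚ)) p.1 T * ∏ k ∈ T, weight (c k)) *
            (abelD (fun i => (c i : ℚ)) p.2 (P.erase i \ T) *
              ∏ k ∈ P.erase i \ T, weight (c k)) = N * W *
        (2 * (1 - 1 / (c i : ℚ)) *
          (n ^ 2 - ∑ j ∈ P.erase i, (c j : ℚ) * (n - c i - c j)) -
        2 * ∑ j ∈ P.erase i, (c j : ℚ) * (c i + c j) ^ 2 * treeG (c i) (c j) / treeV (c i)) := by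
    intro i hi
    have h1 : ∀ p ∈ antidiagonal (c i), weight p.1 * weight p.2 *
          ∑ T ∈ (P.erase i).powerset,
            (abelD (fun i => (c i : ℚ)) p.1 T * ∏ k ∈ T, weight (c k)) *
            (abelD (fun i => (c i : ℚ)) p.2 (P.erase i \ T) *
              ∏ k ∈ P.erase i \ T, weight (c k)) = (∏ k ∈ P.erase i, weight (c k)) *
          (weight p.1 * weight p.2 * ∑ T ∈ (P.erase i).powerset,
            abelD (fun i => (c i : ℚ)) p.1 T * abelD (fun i => (c i : ℚ)) p.2 (P.erase i \ T)) := by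
      intro p _
      rw [mul_left_comm, Finset.mul_sum (P.erase i).powerset _ (∏ k ∈ P.erase i, weight (c k))]
      congr 1
      refine Finset.sum_congr rfl fun T hT => ?_
      rw [← Finset.prod_sdiff (Finset.mem_powerset.1 hT)]
      ring
    rw [Finset.sum_congr rfl h1, ← Finset.mul_sum, sum_cut hc (P.erase i) (hc i) (n := n)
      (by rw [hn, ← Finset.add_sum_erase P c hi]), Finset.card_erase_of_mem hi,
      Nat.cast_sub (Finset.card_pos.2 hP), hW, ← Finset.mul_prod_erase P _ hi, hN,
      show ((P.card : ℤ) - (1 : ℕ) - 3) = P.card - 4 by push_cast; ring, ← Finset.sum_div, treeU,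
      show weight (c i) = c i * treeV (c i) from rfl]
    have := hv (c i)
    have := hx i
    field_simp
  rw [hNN, Finset.sum_congr rfl fun i hi => Finset.sum_congr rfl fun j hj => hjoin i hi j hj,
    Finset.sum_congr rfl hcut]
  simp only [← Finset.mul_sum]
  rw [← mul_add, Finset.sum_sub_distrib]
  have hG : ∑ i ∈ P, 2 * ∑ j ∈ P.erase i,
        (c j : ℚ) * (c i + c j) ^ 2 * treeG (c i) (c j) / treeV (c i) =
      ∑ i ∈ P, ∑ j ∈ P.erase i, ((c i : ℚ) + c j) ^ 2 * treeU (c i + c j) /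
        (treeV (c i) * treeV (c j)) +
      ∑ i ∈ P, ∑ j ∈ P.erase i, ((c i : ℚ) + c j) ^ 2 * (1 - 1 / (c i : ℚ) - 1 / (c j : ℚ)) := by
    rw [← Finset.mul_sum, two_mul]
    conv_lhs => enter [2]; rw [sum_sum_erase_comm]
    simp only [← Finset.sum_add_distrib]
    refine Finset.sum_congr rfl fun i _ => Finset.sum_congr rfl fun j _ => ?_
    have h := treeG_symm (hc i) (hc j)
    have h1 := hv (c i)
    have h2 := hv (c j)
    have h3 := hx i
    have h4 := hx j
    have hu : ∀ k, treeU k = treeV k / k := fun k => rfl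
    rw [hu (c i), hu (c j)] at h
    have h5 : treeU (c i + c j) = c j * treeV (c j) * treeG (c i) (c j) +
      c i * treeV (c i) * treeG (c j) (c i) - treeV (c i) * treeV (c j) +
      treeV (c i) / c i * treeV (c j) + treeV (c j) / c j * treeV (c i) := by
      linear_combination -h
    rw [h5]
    field_simp
    ring
  rw [hG]
  have hpoly := sum_polynomial_identity P (fun i => (c i : ℚ)) hx hn'
  linear_combination (-(1 : ℚ) / 2) * N * W * hpoly

end

section Words

variable {L : Type*} [Fintype L]

/-- The sum of `f` over all words of length `m`. -/
def wordSum : ℕ → (List L → ℚ) → ℚ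
  | 0, f => f []
  | m + 1, f => ∑ x, wordSum m fun l => f (x :: l)

theorem wordSum_eq_sum_ofFn (m : ℕ) (f : List L → ℚ) :
    wordSum m f = ∑ v : Fin m → L, f (List.ofFn v) := by
  induction m generalizing f with
  | zero => simp [wordSum]
  | succ m ih =>
    rw [wordSum, ← (Fin.consEquiv fun _ : Fin (m + 1) => L).sum_comp, Fintype.sum_prod_type]
    refine Finset.sum_congr rfl fun x _ => ?_
    rw [ih]
    refine Finset.sum_congr rfl fun v _ => ?_
    simp [Fin.consEquiv, List.ofFn_succ]

theorem wordSum_add (m : ℕ) (f g : List L → ℚ) :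
    wordSum m (fun l => f l + g l) = wordSum m f + wordSum m g := by
  simp only [wordSum_eq_sum_ofFn, Finset.sum_add_distrib]

theorem wordSum_sum {κ : Type*} (s : Finset κ) (m : ℕ) (f : κ → List L → ℚ) :
    wordSum m (fun l => ∑ k ∈ s, f k l) = ∑ k ∈ s, wordSum m (f k) := by
  simp only [wordSum_eq_sum_ofFn]
  exact Finset.sum_comm

theorem wordSum_zero_fun (m : ℕ) : wordSum m (fun _ : List L => (0 : ℚ)) = 0 := by
  simp [wordSum_eq_sum_ofFn]

open Classical in
/-- Words over the union of two disjoint alphabets are shuffles of words over each of them. -/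
theorem wordSum_shuffle {X Y : L → Prop} (hXY : ∀ e, X e → ¬ Y e) (m : ℕ) (f g : List L → ℚ) :
    wordSum m (fun l => if ∀ e ∈ l, X e ∨ Y e then
        f (l.filter fun e => X e) * g (l.filter fun e => Y e) else 0) =
      ∑ ij ∈ antidiagonal m, (m.choose ij.1 : ℚ) *
        (wordSum ij.1 (fun l => if ∀ e ∈ l, X e then f l else 0) *
          wordSum ij.2 (fun l => if ∀ e ∈ l, Y e then g l else 0)) := by
  induction m generalizing f g with
  | zero => simp [wordSum]
  | succ m ih =>
    rw [Finset.sum_antidiagonal_choose_succ_mul (fun i j =>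
      (wordSum i (fun l => if ∀ e ∈ l, X e then f l else 0) *
          wordSum j (fun l => if ∀ e ∈ l, Y e then g l else 0)))]
    have hf : ∀ i, wordSum (i + 1) (fun l => if ∀ e ∈ l, X e then f l else 0) =
        ∑ x with X x, wordSum i (fun l => if ∀ e ∈ l, X e then f (x :: l) else 0) := by
      intro i
      rw [wordSum, Finset.sum_filter]
      refine Finset.sum_congr rfl fun x _ => ?_
      by_cases hx : X x <;> simp [hx, wordSum_zero_fun]
    have hg : ∀ i, wordSum (i + 1) (fun l => if ∀ e ∈ l, Y e then g l else 0) =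
        ∑ x with Y x, wordSum i (fun l => if ∀ e ∈ l, Y e then g (x :: l) else 0) := by
      intro i
      rw [wordSum, Finset.sum_filter]
      refine Finset.sum_congr rfl fun x _ => ?_
      by_cases hx : Y x <;> simp [hx, wordSum_zero_fun]
    have h : ∀ x, wordSum m (fun l => if ∀ e ∈ x :: l, X e ∨ Y e then
        f ((x :: l).filter fun e => X e) * g ((x :: l).filter fun e => Y e) else 0) =
        (if X x then wordSum m (fun l => if ∀ e ∈ l, X e ∨ Y e then
          f (x :: l.filter fun e => X e) * g (l.filter fun e => Y e) else 0) else 0) +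
        (if Y x then wordSum m (fun l => if ∀ e ∈ l, X e ∨ Y e then
          f (l.filter fun e => X e) * g (x :: l.filter fun e => Y e) else 0) else 0) := by
      intro x
      by_cases hx : X x
      · have hy := hXY x hx
        simp [hx, hy]
      · by_cases hy : Y x <;> simp [hx, hy, wordSum_zero_fun]
    rw [wordSum, Finset.sum_congr rfl fun x _ => h x, Finset.sum_add_distrib,
      ← Finset.sum_filter, ← Finset.sum_filter, add_comm]
    congr 1
    · rw [Finset.sum_congr rfl fun x _ => ih f (fun l => g (x :: l)), Finset.sum_comm]
      refine Finset.sum_congr rfl fun ij _ => ?_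
      rw [hg, Finset.mul_sum, Finset.mul_sum]
    · rw [Finset.sum_congr rfl fun x _ => ih (fun l => f (x :: l)) g, Finset.sum_comm]
      refine Finset.sum_congr rfl fun ij hij => ?_
      rw [hf, Finset.sum_mul, Finset.mul_sum]
      rw [← Nat.choose_symm_of_eq_add (HasAntidiagonal.mem_antidiagonal.1 hij).symm]

end Words

section Factorizations

open Equiv

variable {α : Type*}

/-- `s` is a union of orbits of the group generated by the letters of `l`. -/
def Invariant (l : List (Perm α)) (s : Set α) : Prop := ∀ e ∈ l, ∀ z, z ∈ s ↔ e z ∈ s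

/-- `x` and `y` lie in the same orbit of the group generated by the letters of `l`. -/
def Rel (l : List (Perm α)) (x y : α) : Prop := ∀ s, Invariant l s → (x ∈ s ↔ y ∈ s)

theorem rel_refl (l : List (Perm α)) (x : α) : Rel l x x := fun _ _ => Iff.rfl

theorem Rel.symm {l : List (Perm α)} {x y : α} (h : Rel l x y) : Rel l y x :=
  fun s hs => (h s hs).symm

theorem Rel.trans {l : List (Perm α)} {x y z : α} (h : Rel l x y) (h' : Rel l y z) : Rel l x z :=
  fun s hs => (h s hs).trans (h' s hs)

theorem Rel.mono {l l' : List (Perm α)} (hl : l ⊆ l') {x y : α} (h : Rel l x y) : Rel l' x y :=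
  fun s hs => h s fun e he => hs e (hl he)

theorem rel_apply {l : List (Perm α)} {e : Perm α} (he : e ∈ l) (z : α) : Rel l z (e z) :=
  fun _ hs => hs e he z

theorem invariant_rel (l : List (Perm α)) (a : α) : Invariant l {z | Rel l a z} :=
  fun _ he z => ⟨fun h => Rel.trans h (rel_apply he z), fun h => Rel.trans h (rel_apply he z).symm⟩

theorem rel_iff_exists_closure {l : List (Perm α)} {x y : α} :
    Rel l x y ↔ ∃ g ∈ Subgroup.closure {e | e ∈ l}, g x = y := by
  constructor
  · intro h
    refine (h {y | ∃ g ∈ Subgroup.closure {e | e ∈ l}, g x = y} ?_).1 ⟨1, Subgroup.one_mem _, rfl⟩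
    intro e he z
    have he' : e ∈ Subgroup.closure {e | e ∈ l} := Subgroup.subset_closure he
    constructor
    · rintro ⟨g, hg, rfl⟩
      exact ⟨e * g, Subgroup.mul_mem _ he' hg, rfl⟩
    · rintro ⟨g, hg, h⟩
      exact ⟨e⁻¹ * g, Subgroup.mul_mem _ (Subgroup.inv_mem _ he') hg, by simp [h]⟩
  · rintro ⟨g, hg, rfl⟩
    induction hg using Subgroup.closure_induction generalizing x with
    | mem e he => exact rel_apply he x
    | one => exact rel_refl l x
    | mul g h _ _ hg hh => exact hh.trans hg
    | inv g _ hg =>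
      have := (hg (x := g⁻¹ x)).symm
      simpa using this

variable [Fintype α] [DecidableEq α]

/-- The transpositions of two elements of `A`. -/
def Letter (A : Finset α) (e : Perm α) : Prop := e.IsSwap ∧ e.support ⊆ A

theorem Letter.mono {A B : Finset α} (h : A ⊆ B) {e : Perm α} (he : Letter A e) : Letter B e :=
  ⟨he.1, he.2.trans h⟩

theorem Letter.disjoint {A B : Finset α} (h : Disjoint A B) (e : Perm α) (he : Letter A e) :
    ¬ Letter B e := by
  intro he'
  have : e.support = ∅ := by
    rw [← Finset.subset_empty]
    exact (Finset.disjoint_iff_inter_eq_empty.1 h) ▸ Finset.subset_inter he.2 he'.2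
  have h2 := Perm.card_support_eq_two.2 he.1
  simp [this] at h2

theorem Letter.apply_eq {A : Finset α} {e : Perm α} (he : Letter A e) {x : α} (hx : x ∉ A) :
    e x = x := by
  by_contra h
  exact hx (he.2 (Perm.mem_support.2 h))

theorem Letter.apply_mem_iff {A : Finset α} {e : Perm α} (he : Letter A e) (x : α) :
    x ∈ A ↔ e x ∈ A := by
  by_cases hx : e x = x
  · rw [hx]
  · exact ⟨fun _ => he.2 (Perm.apply_mem_support.2 (Perm.mem_support.2 hx)),
      fun _ => he.2 (Perm.mem_support.2 hx)⟩

/-- The letters of `l` are transpositions of elements of `A` generating a group which is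
transitive on `A`. -/
def Conn (A : Finset α) (l : List (Perm α)) : Prop :=
  (∀ e ∈ l, Letter A e) ∧ ∀ x ∈ A, ∀ y ∈ A, Rel l x y

/-- `l` is a transitive factorization of the restriction of `σ` to `A`. -/
def Fac (A : Finset α) (σ : Perm α) (l : List (Perm α)) : Prop :=
  Conn A l ∧ ∀ x ∈ A, l.prod x = σ x

open Classical in
/-- The number of transitive factorizations of length `m` of the restriction of `σ` to `A`. -/
noncomputable def cnt (A : Finset α) (m : ℕ) (σ : Perm α) : ℚ :=
  wordSum m fun l => if Fac A σ l then 1 else 0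

section Split

variable {A B : Finset α} {l : List (Perm α)}

theorem invariant_left (h : Disjoint A B) (hl : ∀ e ∈ l, Letter A e ∨ Letter B e) :
    Invariant l (A : Set α) := by
  intro e he z
  rcases hl e he with h1 | h1
  · exact h1.apply_mem_iff z
  · by_cases hz : z ∈ B
    · have hz' := (h1.apply_mem_iff z).1 hz
      simp [Finset.disjoint_right.1 h hz, Finset.disjoint_right.1 h hz']
    · rw [h1.apply_eq hz]

open Classical in
theorem rel_filter (h : Disjoint A B) (hl : ∀ e ∈ l, Letter A e ∨ Letter B e) {x y : α}
    (hx : x ∈ A) (hy : y ∈ A) (hxy : Rel l x y) : Rel (l.filter fun e => Letter A e) x y := by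
  intro s hs
  have := hxy (s ∩ A) ?_
  · simpa [hx, hy] using this
  intro e he z
  rcases hl e he with h1 | h1
  · have h2 := hs e (by simp [he, h1]) z
    have h3 := h1.apply_mem_iff z
    simp [h2, h3]
  · by_cases hz : z ∈ B
    · have hz' := (h1.apply_mem_iff z).1 hz
      simp [Finset.disjoint_right.1 h hz, Finset.disjoint_right.1 h hz']
    · rw [h1.apply_eq hz]

open Classical in
theorem prod_filter_apply (h : Disjoint A B) (hl : ∀ e ∈ l, Letter A e ∨ Letter B e) {x : α}
    (hx : x ∈ A) : (l.filter fun e => Letter A e).prod x = l.prod x ∧ l.prod x ∈ A := by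
  induction l with
  | nil => simpa using hx
  | cons e l ih =>
    obtain ⟨ih1, ih2⟩ := ih fun e he => hl e (List.mem_cons_of_mem _ he)
    rcases hl e List.mem_cons_self with h1 | h1
    · simp [h1, ih1, ← h1.apply_mem_iff, ih2]
    · have h2 := Letter.disjoint h.symm e h1
      have h3 := h1.apply_eq (Finset.disjoint_left.1 h ih2)
      simp [h2, ih1, h3, ih2]

end Split

theorem Fac.apply_mem {A : Finset α} {σ : Perm α} {l : List (Perm α)} (h : Fac A σ l) {x : α}
    (hx : x ∈ A) : σ x ∈ A := by
  rw [← h.2 x hx]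
  exact (prod_filter_apply (B := ∅) (by simp) (fun e he => Or.inl (h.1.1 e he)) hx).2

theorem cnt_eq_zero_of_not_mem {A : Finset α} {σ : Perm α} {x : α} (hx : x ∈ A) (hσ : σ x ∉ A)
    (m : ℕ) : cnt A m σ = 0 := by
  have : ∀ l, ¬ Fac A σ l := fun l h => hσ (h.apply_mem hx)
  simp [cnt, this, wordSum_zero_fun]

open Classical in
/-- The letters of `l` split along the partition of `A` into `B` and its complement, and both
parts are transitive factorizations. -/
def Splits (A B : Finset α) (σ : Perm α) (l : List (Perm α)) : Prop :=
  (∀ e ∈ l, Letter B e ∨ Letter (A \ B) e) ∧ Fac B σ (l.filter fun e => Letter B e) ∧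
    Fac (A \ B) σ (l.filter fun e => Letter (A \ B) e)

section

variable {A B : Finset α} {σ : Perm α} {l : List (Perm α)} {a b : α}

theorem Letter.of_swap (ha : a ∈ A) (hb : b ∈ A) (hab : a ≠ b) : Letter A (swap a b) := by
  refine ⟨⟨a, b, hab, rfl⟩, ?_⟩
  rw [Perm.support_swap hab]
  intro x
  simp only [mem_insert, mem_singleton]
  rintro (rfl | rfl) <;> assumption

theorem fac_cons_iff :
    Fac A σ (swap a b :: l) ↔
      Conn A (swap a b :: l) ∧ ∀ x ∈ A, l.prod x = (swap a b * σ) x := by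
  refine and_congr_right fun _ => forall₂_congr fun x _ => ?_
  rw [List.prod_cons, Perm.mul_apply, Perm.mul_apply, swap_apply_eq_iff]

theorem Splits.prod_apply (h : Splits A B σ l) {x : α} (hx : x ∈ A) : l.prod x = σ x := by
  classical
  obtain ⟨h1, h2, h3⟩ := h
  by_cases hxB : x ∈ B
  · rw [← h2.2 x hxB, (prod_filter_apply disjoint_sdiff h1 hxB).1]
  · have hx' : x ∈ A \ B := by simp [hx, hxB]
    rw [← h3.2 x hx', (prod_filter_apply sdiff_disjoint (fun e he => (h1 e he).symm) hx').1]

theorem Splits.rel (h : Splits A B σ l) (ha : a ∈ B) {x : α} :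
    Rel l a x ↔ x ∈ B := by
  classical
  constructor
  · intro hx
    exact (hx _ (invariant_left disjoint_sdiff h.1)).1 ha
  · intro hx
    exact (h.2.1.1.2 a ha x hx).mono ((List.filter_subset_self _))

theorem Splits.conn_cons (h : Splits A B σ l) (hB : B ⊆ A) (ha : a ∈ B) (hb : b ∈ A \ B)
    (hab : a ≠ b) : Conn A (swap a b :: l) := by
  classical
  refine ⟨?_, ?_⟩
  · intro e he
    rcases List.mem_cons.1 he with rfl | he
    · exact Letter.of_swap (hB ha) (mem_sdiff.1 hb).1 hab
    · exact (h.1 e he).elim (Letter.mono hB) (Letter.mono sdiff_subset)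
  · have key : ∀ x ∈ A, Rel (swap a b :: l) a x := by
      intro x hx
      by_cases hxB : x ∈ B
      · exact ((h.rel ha).2 hxB).mono (List.subset_cons_self _ _)
      · have h1 : Rel (swap a b :: l) a b := by
          simpa using rel_apply (l := swap a b :: l) List.mem_cons_self a
        refine h1.trans ?_
        exact (h.2.2.1.2 b hb x (by simp [hx, hxB])).mono
          (List.Subset.trans ((List.filter_subset_self _)) (List.subset_cons_self _ _))
    exact fun x hx y hy => (key x hx).symm.trans (key y hy)

open Classical in
theorem splits_of_conn_cons (hc : Conn A (swap a b :: l)) (hprod : ∀ x ∈ A, l.prod x = σ x)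
    (ha : a ∈ A) (hb : b ∈ A) (hl : ¬ Rel l a b) :
    Splits A (A.filter fun x => Rel l a x) σ l := by
  set O := A.filter fun x => Rel l a x with hO
  have hOA : O ⊆ A := filter_subset _ _
  have haO : a ∈ O := by simp [hO, ha, rel_refl]
  have hbO : b ∈ A \ O := by simp [hO, hb, hl]
  have hlet : ∀ e ∈ l, Letter A e := fun e he => hc.1 e (List.mem_cons_of_mem _ he)
  have hOinv : Invariant l (O : Set α) := by
    intro e he z
    have h1 := (hlet e he).apply_mem_iff z
    have h2 := invariant_rel l a e he z
    simp only [Set.mem_ofPred_eq] at h2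
    simp [hO, ← h1, ← h2]
  have hD : ∀ e ∈ l, Letter O e ∨ Letter (A \ O) e := by
    intro e he
    obtain ⟨hs, hA⟩ := hlet e he
    obtain ⟨c, d, hcd, rfl⟩ := hs
    rw [Perm.support_swap hcd] at hA
    have hcA : c ∈ A := hA (by simp)
    have hdA : d ∈ A := hA (by simp)
    have := hOinv _ he c
    simp only [swap_apply_left, mem_coe] at this
    by_cases hcO : c ∈ O
    · exact Or.inl (Letter.of_swap hcO (this.1 hcO) hcd)
    · exact Or.inr (Letter.of_swap (mem_sdiff.2 ⟨hcA, hcO⟩)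
        (mem_sdiff.2 ⟨hdA, fun h => hcO (this.2 h)⟩) hcd)
  have hD' : ∀ e ∈ l, Letter (A \ O) e ∨ Letter O e := fun e he => (hD e he).symm
  have hAOinv : Invariant l ((A \ O : Finset α) : Set α) := invariant_left sdiff_disjoint hD'
  refine ⟨hD, ⟨⟨by simp, ?_⟩, fun x hx => ?_⟩, ⟨⟨by simp, ?_⟩, fun x hx => ?_⟩⟩
  · have key : ∀ x ∈ O, Rel (l.filter fun e => Letter O e) a x := fun x hx =>
      rel_filter disjoint_sdiff hD haO hx (mem_filter.1 hx).2
    exact fun x hx y hy => (key x hx).symm.trans (key y hy)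
  · rw [(prod_filter_apply disjoint_sdiff hD hx).1, hprod x (hOA hx)]
  · have key : ∀ x ∈ A \ O, Rel (l.filter fun e => Letter (A \ O) e) b x := by
      intro x hx
      refine rel_filter sdiff_disjoint hD' hbO hx ?_
      intro s hs
      have h := hc.2 a ha x (mem_sdiff.1 hx).1 {z | z ∈ O ∧ b ∈ s ∨ z ∈ A \ O ∧ z ∈ s} ?_
      · have hxO := (mem_sdiff.1 hx).2
        have haO' : a ∉ A \ O := by simp [haO]
        simpa [-mem_sdiff, haO, hx, hxO, haO'] using h
      intro e he z
      rcases List.mem_cons.1 he with rfl | he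
      · by_cases hza : z = a
        · subst hza
          have h1 : b ∉ O := (mem_sdiff.1 hbO).2
          simp [haO, hb, h1]
        · by_cases hzb : z = b
          · subst hzb
            have h1 : z ∉ O := (mem_sdiff.1 hbO).2
            simp [haO, hb, h1]
          · rw [swap_apply_of_ne_of_ne hza hzb]
      · have h1 := hOinv e he z
        have h2 := hAOinv e he z
        have h3 := hs e he z
        simp only [mem_coe] at h1 h2
        simp only [Set.mem_ofPred_eq, ← h1, ← h2, ← h3]
    exact fun x hx y hy => (key x hx).symm.trans (key y hy)
  · rw [(prod_filter_apply sdiff_disjoint hD' hx).1, hprod x (mem_sdiff.1 hx).1]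

open Classical in
/-- Removing the first letter `(a b)` of a transitive factorization leaves either a transitive
factorization or a pair of transitive factorizations of complementary subsets. -/
theorem indicator_fac_cons (ha : a ∈ A) (hb : b ∈ A) (hab : a ≠ b) :
    (if Fac A σ (swap a b :: l) then (1 : ℚ) else 0) =
      (if Fac A (swap a b * σ) l then 1 else 0) +
        ∑ B ∈ A.powerset with a ∈ B ∧ b ∉ B,
          if Splits A B (swap a b * σ) l then 1 else 0 := by
  rw [fac_cons_iff]
  by_cases hc : Conn A l
  · have hc' : Conn A (swap a b :: l) := by
      refine ⟨?_, fun x hx y hy => (hc.2 x hx y hy).mono (List.subset_cons_self _ _)⟩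
      intro e he
      rcases List.mem_cons.1 he with rfl | he
      · exact Letter.of_swap ha hb hab
      · exact hc.1 e he
    rw [Finset.sum_eq_zero, add_zero, Fac]
    · simp only [hc, hc']
    · intro B hB
      simp only [mem_filter, mem_powerset] at hB
      exact if_neg fun h => hB.2.2 ((h.rel hB.2.1).1 (hc.2 a ha b hb))
  · rw [if_neg (fun h : Fac A (swap a b * σ) l => hc h.1), zero_add]
    by_cases h : Conn A (swap a b :: l) ∧ ∀ x ∈ A, l.prod x = (swap a b * σ) x
    · have hl : ¬ Rel l a b := by
        intro hr
        refine hc ⟨fun e he => h.1.1 e (List.mem_cons_of_mem _ he), fun x hx y hy s hs => ?_⟩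
        refine h.1.2 x hx y hy s ?_
        intro e he z
        rcases List.mem_cons.1 he with rfl | he
        · have := hr s hs
          by_cases hza : z = a
          · simp [hza, this]
          · by_cases hzb : z = b
            · simp [hzb, this]
            · rw [swap_apply_of_ne_of_ne hza hzb]
        · exact hs e he z
      rw [if_pos h, Finset.sum_eq_single (A.filter fun x => Rel l a x),
        if_pos (splits_of_conn_cons h.1 h.2 ha hb hl)]
      · intro B hB hne
        simp only [mem_filter, mem_powerset] at hB
        refine if_neg fun hs => hne ?_
        ext x
        rw [mem_filter, hs.rel hB.2.1]
        exact ⟨fun hx => ⟨hB.1 hx, hx⟩, fun hx => hx.2⟩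
      · intro hn
        exact absurd (by simp [ha, hl, rel_refl]) hn
    · rw [if_neg h, Finset.sum_eq_zero]
      intro B hB
      simp only [mem_filter, mem_powerset] at hB
      refine if_neg fun hs => h ⟨?_, fun x hx => hs.prod_apply hx⟩
      exact hs.conn_cons hB.1 hB.2.1 (by simp [hb, hB.2.2]) hab

theorem wordSum_splits (A B : Finset α) (m : ℕ) (σ : Perm α) [DecidablePred (Splits A B σ)] :
    wordSum m (fun l => if Splits A B σ l then (1 : ℚ) else 0) =
      ∑ ij ∈ antidiagonal m, (m.choose ij.1 : ℚ) * (cnt B ij.1 σ * cnt (A \ B) ij.2 σ) := by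
  classical
  have := wordSum_shuffle (Letter.disjoint (disjoint_sdiff (s := B) (t := A))) m
    (fun l => if Fac B σ l then 1 else 0) (fun l => if Fac (A \ B) σ l then 1 else 0)
  have h : ∀ (C : Finset α) (i : ℕ), wordSum i (fun l => if ∀ e ∈ l, Letter C e then
      (if Fac C σ l then (1 : ℚ) else 0) else 0) = cnt C i σ := by
    intro C i
    refine congrArg _ (funext fun l => ?_)
    by_cases hl : Fac C σ l
    · rw [if_pos hl, if_pos hl.1.1]
    · simp [hl]
  refine Eq.trans ?_ (this.trans (Finset.sum_congr rfl fun ij _ => ?_))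
  swap
  · congr 2
    · convert h B ij.1
    · convert h (A \ B) ij.2
  refine congrArg _ (funext fun l => ?_)
  by_cases hl : ∀ e ∈ l, Letter B e ∨ Letter (A \ B) e
  · rw [if_pos hl]
    by_cases h1 : Fac B σ (l.filter fun e => Letter B e)
    · by_cases h2 : Fac (A \ B) σ (l.filter fun e => Letter (A \ B) e)
      · rw [if_pos h1, if_pos h2, if_pos ⟨hl, h1, h2⟩, mul_one]
      · rw [if_neg h2, if_neg fun h => h2 h.2.2, mul_zero]
    · rw [if_neg h1, if_neg fun h => h1 h.2.1, zero_mul]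
  · rw [if_neg hl, if_neg fun h => hl h.1]

omit [Fintype α] in
theorem isSwap_eq_swap_apply {τ : Perm α} (h : τ.IsSwap) {x : α} (hx : τ x ≠ x) :
    τ = swap x (τ x) := by
  obtain ⟨c, d, hcd, rfl⟩ := h
  by_cases hc : x = c
  · simp [hc]
  · by_cases hd : x = d
    · simp [hd, swap_comm]
    · exact absurd (swap_apply_of_ne_of_ne hc hd) hx

open Classical in
theorem two_mul_sum_letter (A : Finset α) (φ : Perm α → ℚ) :
    2 * ∑ τ with Letter A τ, φ τ = ∑ a ∈ A, ∑ b ∈ A.erase a, φ (swap a b) := by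
  have h1 : ∀ τ ∈ (univ.filter fun τ => Letter A τ), 2 * φ τ = ∑ a ∈ A with τ a ≠ a, φ τ := by
    intro τ hτ
    have hτ' := (mem_filter.1 hτ).2
    have h2 : A.filter (fun a => τ a ≠ a) = τ.support := by
      ext a
      simp only [mem_filter, Perm.mem_support, and_iff_right_iff_imp]
      exact fun h => hτ'.2 (Perm.mem_support.2 h)
    rw [Finset.sum_const, h2, Perm.card_support_eq_two.2 hτ'.1, nsmul_eq_mul, Nat.cast_ofNat]
  rw [Finset.mul_sum, Finset.sum_congr rfl h1]
  simp only [Finset.sum_filter (s := A)]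
  rw [Finset.sum_comm]
  refine Finset.sum_congr rfl fun a ha => ?_
  rw [← Finset.sum_filter]
  refine Finset.sum_bij' (fun τ _ => τ a) (fun b _ => swap a b) ?_ ?_ ?_ ?_ ?_
  · intro τ hτ
    simp only [mem_filter, mem_univ, true_and] at hτ
    exact mem_erase.2 ⟨hτ.2, (hτ.1.apply_mem_iff a).1 ha⟩
  · intro b hb
    obtain ⟨hb1, hb2⟩ := mem_erase.1 hb
    simp only [mem_filter, mem_univ, true_and, swap_apply_left]
    exact ⟨Letter.of_swap ha hb2 hb1.symm, hb1⟩
  · intro τ hτ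
    simp only [mem_filter, mem_univ, true_and] at hτ
    exact (isSwap_eq_swap_apply hτ.1.1 hτ.2).symm
  · intro b _
    simp
  · intro τ hτ
    simp only [mem_filter, mem_univ, true_and] at hτ
    rw [← isSwap_eq_swap_apply hτ.1.1 hτ.2]

/-- The cut-and-join recursion for the number of transitive factorizations. -/
theorem two_mul_cnt_succ (A : Finset α) (m : ℕ) (σ : Perm α) :
    2 * cnt A (m + 1) σ = ∑ a ∈ A, ∑ b ∈ A.erase a, (cnt A m (swap a b * σ) +
      ∑ B ∈ A.powerset with a ∈ B ∧ b ∉ B, ∑ ij ∈ antidiagonal m,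
        (m.choose ij.1 : ℚ) * (cnt B ij.1 (swap a b * σ) * cnt (A \ B) ij.2 (swap a b * σ))) := by
  classical
  have h : ∀ τ : Perm α, wordSum m (fun l => if Fac A σ (τ :: l) then (1 : ℚ) else 0) =
      if Letter A τ then wordSum m (fun l => if Fac A σ (τ :: l) then (1 : ℚ) else 0) else 0 := by
    intro τ
    split_ifs with hτ
    · rfl
    · have : ∀ l, ¬ Fac A σ (τ :: l) := fun l hl => hτ (hl.1.1 τ List.mem_cons_self)
      simp [this, wordSum_zero_fun]
  have h0 : cnt A (m + 1) σ =
      ∑ τ, wordSum m (fun l => if Fac A σ (τ :: l) then (1 : ℚ) else 0) := by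
    rw [cnt, wordSum]
  rw [h0, Finset.sum_congr rfl fun τ _ => h τ, ← Finset.sum_filter, two_mul_sum_letter]
  refine Finset.sum_congr rfl fun a ha => Finset.sum_congr rfl fun b hb => ?_
  obtain ⟨hb1, hb2⟩ := mem_erase.1 hb
  have h2 := funext fun l => indicator_fac_cons (σ := σ) (l := l) ha hb2 hb1.symm
  have h3 := congrArg (wordSum m) h2
  rw [wordSum_add, wordSum_sum] at h3
  refine Eq.trans ?_ (h3.trans ?_)
  · congr
  · congr 1
    refine Finset.sum_congr (by congr) fun B _ => ?_
    exact wordSum_splits A B m _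

end

end Factorizations

section Cycles

open Equiv

variable {α : Type*} [Fintype α] [DecidableEq α]

/-- The cycle of `σ` through `a`, as a set. -/
def cyc (σ : Perm α) (a : α) : Finset α := univ.filter fun x => σ.SameCycle a x

variable {σ : Perm α} {a b x y : α}

theorem mem_cyc : x ∈ cyc σ a ↔ σ.SameCycle a x := by simp [cyc]

theorem self_mem_cyc (σ : Perm α) (a : α) : a ∈ cyc σ a := mem_cyc.2 (Perm.SameCycle.refl _ _)

theorem cyc_eq_iff : cyc σ x = cyc σ y ↔ σ.SameCycle x y := by
  constructor
  · intro h
    rw [← mem_cyc, h]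
    exact self_mem_cyc σ y
  · intro h
    ext z
    rw [mem_cyc, mem_cyc]
    exact ⟨fun hz => h.symm.trans hz, fun hz => h.trans hz⟩

theorem cyc_eq_of_mem (h : x ∈ cyc σ a) : cyc σ x = cyc σ a := (cyc_eq_iff.2 (mem_cyc.1 h)).symm

theorem iterate_mem_cyc (σ : Perm α) (a : α) (i : ℕ) : σ^[i] a ∈ cyc σ a :=
  mem_cyc.2 ⟨i, by rw [zpow_natCast, Perm.iterate_eq_pow]⟩

theorem mem_cyc_iff_exists_iterate : x ∈ cyc σ a ↔ ∃ i : ℕ, σ^[i] a = x := by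
  constructor
  · intro h
    obtain ⟨i, hi⟩ := (mem_cyc.1 h).exists_nat_pow_eq
    exact ⟨i, by rw [Perm.iterate_eq_pow, hi]⟩
  · rintro ⟨i, rfl⟩
    exact iterate_mem_cyc σ a i

theorem cyc_eq_image_range {k : ℕ} (hk : 0 < k) (h : σ^[k] a = a) :
    cyc σ a = (range k).image fun i => σ^[i] a := by
  ext x
  rw [mem_cyc_iff_exists_iterate, mem_image]
  constructor
  · rintro ⟨i, rfl⟩
    exact ⟨i % k, mem_range.2 (Nat.mod_lt _ hk),
      Function.IsPeriodicPt.iterate_mod_apply (show Function.IsPeriodicPt σ k a from h) i⟩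
  · rintro ⟨i, _, rfl⟩
    exact ⟨i, rfl⟩

omit [DecidableEq α] in
theorem minimalPeriod_pos (σ : Perm α) (a : α) : 0 < Function.minimalPeriod σ a := by
  refine Function.minimalPeriod_pos_of_mem_periodicPts ?_
  exact σ.injective.mem_periodicPts a

theorem card_cyc (σ : Perm α) (a : α) : (cyc σ a).card = Function.minimalPeriod σ a := by
  rw [cyc_eq_image_range (minimalPeriod_pos σ a) (Function.isPeriodicPt_minimalPeriod σ a),
    card_image_of_injOn, card_range]
  intro i hi j hj h
  exact Function.iterate_injOn_Iio_minimalPeriod (by simpa using hi) (by simpa using hj) h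

theorem iterate_eq_iterate_iff {i j : ℕ} (hi : i < (cyc σ a).card) (hj : j < (cyc σ a).card) :
    σ^[i] a = σ^[j] a ↔ i = j := by
  rw [card_cyc] at hi hj
  exact ⟨fun h => Function.iterate_injOn_Iio_minimalPeriod hi hj h, fun h => by rw [h]⟩

theorem iterate_card_cyc (σ : Perm α) (a : α) : σ^[(cyc σ a).card] a = a := by
  rw [card_cyc]; exact Function.isPeriodicPt_minimalPeriod σ a

theorem card_cyc_pos (σ : Perm α) (a : α) : 0 < (cyc σ a).card := by
  rw [card_cyc]; exact minimalPeriod_pos σ a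

theorem cyc_eq_image (σ : Perm α) (a : α) :
    cyc σ a = (range (cyc σ a).card).image fun i => σ^[i] a :=
  cyc_eq_image_range (card_cyc_pos σ a) (iterate_card_cyc σ a)

theorem exists_iterate_lt (h : x ∈ cyc σ a) : ∃ i < (cyc σ a).card, σ^[i] a = x := by
  rw [cyc_eq_image] at h
  simpa using h

omit [Fintype α] in
theorem iterate_swap_mul {k : ℕ} (h : ∀ i, i + 1 < k → σ^[i + 1] x ≠ a ∧ σ^[i + 1] x ≠ b) :
    ∀ i < k, (swap a b * σ)^[i] x = σ^[i] x := by
  intro i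
  induction i with
  | zero => simp
  | succ i ih =>
    intro hi
    rw [Function.iterate_succ_apply', ih (by omega), Perm.mul_apply,
      ← Function.iterate_succ_apply' σ, swap_apply_of_ne_of_ne (h i hi).1 (h i hi).2]

omit [Fintype α] in
theorem iterate_swap_mul_last {k : ℕ} (hk : 0 < k)
    (h : ∀ i, i + 1 < k → σ^[i + 1] x ≠ a ∧ σ^[i + 1] x ≠ b) :
    (swap a b * σ)^[k] x = swap a b (σ^[k] x) := by
  obtain ⟨k, rfl⟩ := Nat.exists_eq_succ_of_ne_zero hk.ne'
  rw [Function.iterate_succ_apply', iterate_swap_mul h k (Nat.lt_succ_self k), Perm.mul_apply,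
    ← Function.iterate_succ_apply' σ]

theorem cyc_swap_mul_of_not_mem (ha : a ∉ cyc σ x) (hb : b ∉ cyc σ x) :
    cyc (swap a b * σ) x = cyc σ x := by
  have h : ∀ i, (swap a b * σ)^[i] x = σ^[i] x := by
    intro i
    refine iterate_swap_mul (k := i + 1) (fun j _ => ⟨?_, ?_⟩) i (Nat.lt_succ_self i)
    · rintro rfl
      exact ha (iterate_mem_cyc σ x _)
    · rintro rfl
      exact hb (iterate_mem_cyc σ x _)
  ext y
  simp only [mem_cyc_iff_exists_iterate, h]

section Cut

variable {p : ℕ} (hp : 0 < p) (hpk : p < (cyc σ a).card)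
include hp hpk

theorem cyc_swap_iterate_left :
    cyc (swap a (σ^[p] a) * σ) a = (range p).image fun i => σ^[i] a := by
  have h : ∀ i, i + 1 < p → σ^[i + 1] a ≠ a ∧ σ^[i + 1] a ≠ σ^[p] a := by
    intro i hi
    constructor
    · intro h
      have := (iterate_eq_iterate_iff (σ := σ) (a := a) (i := i + 1) (j := 0) (by omega)
        (by omega)).1 h
      omega
    · intro h
      have := (iterate_eq_iterate_iff (by omega) hpk).1 h
      omega
  rw [cyc_eq_image_range hp (by rw [iterate_swap_mul_last hp h, swap_apply_right])]
  refine Finset.image_congr fun i hi => ?_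
  exact iterate_swap_mul h i (by simpa using hi)

theorem card_cyc_swap_iterate_left : (cyc (swap a (σ^[p] a) * σ) a).card = p := by
  rw [cyc_swap_iterate_left hp hpk, card_image_of_injOn, card_range]
  intro i hi j hj h
  simp only [coe_range, Set.mem_Iio] at hi hj
  exact (iterate_eq_iterate_iff (by omega) (by omega)).1 h

theorem cyc_swap_iterate_right : cyc (swap a (σ^[p] a) * σ) (σ^[p] a) =
    (range ((cyc σ a).card - p)).image fun i => σ^[i + p] a := by
  have h : ∀ i, i + 1 < (cyc σ a).card - p →
      σ^[i + 1] (σ^[p] a) ≠ a ∧ σ^[i + 1] (σ^[p] a) ≠ σ^[p] a := by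
    intro i hi
    rw [← Function.iterate_add_apply]
    constructor
    · intro h
      have := (iterate_eq_iterate_iff (σ := σ) (a := a) (i := i + 1 + p) (j := 0) (by omega)
        (by omega)).1 h
      omega
    · intro h
      have := (iterate_eq_iterate_iff (by omega) hpk).1 h
      omega
  rw [cyc_eq_image_range (k := (cyc σ a).card - p) (by omega) (by
    rw [iterate_swap_mul_last (by omega) h, ← Function.iterate_add_apply, Nat.sub_add_cancel hpk.le,
      iterate_card_cyc, swap_apply_left])]
  refine Finset.image_congr fun i hi => ?_
  simp only [coe_range, Set.mem_Iio] at hi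
  rw [iterate_swap_mul h i hi, Function.iterate_add_apply]

theorem cyc_swap_iterate_union : cyc (swap a (σ^[p] a) * σ) a ∪
    cyc (swap a (σ^[p] a) * σ) (σ^[p] a) = cyc σ a := by
  rw [cyc_swap_iterate_left hp hpk, cyc_swap_iterate_right hp hpk]
  conv_rhs => rw [cyc_eq_image]
  ext x
  simp only [mem_union, mem_image, mem_range]
  constructor
  · rintro (⟨i, hi, rfl⟩ | ⟨i, hi, rfl⟩)
    · exact ⟨i, by omega, rfl⟩
    · exact ⟨i + p, by omega, rfl⟩
  · rintro ⟨i, hi, rfl⟩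
    by_cases h : i < p
    · exact Or.inl ⟨i, h, rfl⟩
    · exact Or.inr ⟨i - p, by omega, by rw [Nat.sub_add_cancel (by omega)]⟩

theorem iterate_not_mem_cyc_swap : σ^[p] a ∉ cyc (swap a (σ^[p] a) * σ) a := by
  rw [cyc_swap_iterate_left hp hpk]
  simp only [mem_image, mem_range, not_exists, not_and]
  intro i hi h
  have := (iterate_eq_iterate_iff (by omega) hpk).1 h
  omega

end Cut

theorem exists_iterate_of_mem_cyc (hab : a ≠ b) (hb : b ∈ cyc σ a) :
    ∃ p, 0 < p ∧ p < (cyc σ a).card ∧ σ^[p] a = b := by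
  obtain ⟨p, hp, h⟩ := exists_iterate_lt hb
  refine ⟨p, Nat.pos_of_ne_zero ?_, hp, h⟩
  rintro rfl
  exact hab h

theorem cyc_swap_union_of_mem (hab : a ≠ b) (hb : b ∈ cyc σ a) :
    cyc (swap a b * σ) a ∪ cyc (swap a b * σ) b = cyc σ a := by
  obtain ⟨p, h1, h2, rfl⟩ := exists_iterate_of_mem_cyc hab hb
  exact cyc_swap_iterate_union h1 h2

theorem not_mem_cyc_swap_of_mem (hab : a ≠ b) (hb : b ∈ cyc σ a) : b ∉ cyc (swap a b * σ) a := by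
  obtain ⟨p, h1, h2, rfl⟩ := exists_iterate_of_mem_cyc hab hb
  exact iterate_not_mem_cyc_swap h1 h2

theorem mem_cyc_swap_of_not_mem (hb : b ∉ cyc σ a) : b ∈ cyc (swap a b * σ) a := by
  have h : (swap a b * σ)^[(cyc σ a).card] a = b := by
    rw [iterate_swap_mul_last (card_cyc_pos σ a), iterate_card_cyc, swap_apply_left]
    intro i hi
    refine ⟨fun h => ?_, fun h => hb (h ▸ iterate_mem_cyc σ a _)⟩
    have := (iterate_eq_iterate_iff (σ := σ) (a := a) (i := i + 1) (j := 0) hi (by omega)).1 h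
    omega
  exact mem_cyc_iff_exists_iterate.2 ⟨_, h⟩

theorem cyc_swap_of_not_mem (hb : b ∉ cyc σ a) :
    cyc (swap a b * σ) a = cyc σ a ∪ cyc σ b := by
  have hab : a ≠ b := by
    rintro rfl
    exact hb (self_mem_cyc σ a)
  have := cyc_swap_union_of_mem hab (mem_cyc_swap_of_not_mem hb)
  rw [← this, ← mul_assoc, swap_mul_self, one_mul]

theorem disjoint_cyc (hb : b ∉ cyc σ a) : Disjoint (cyc σ a) (cyc σ b) := by
  rw [Finset.disjoint_left]
  intro x hx hx'
  exact hb (mem_cyc.2 ((mem_cyc.1 hx).trans (mem_cyc.1 hx').symm))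

end Cycles

section Orbits

open Equiv

variable {α : Type*} [Fintype α] [DecidableEq α]

/-- `A` is mapped to itself by `σ`. -/
def Stable (σ : Perm α) (A : Finset α) : Prop := ∀ x ∈ A, σ x ∈ A

/-- The set of cycles of `σ` meeting `A`. -/
def orb (σ : Perm α) (A : Finset α) : Finset (Finset α) := A.image (cyc σ)

variable {σ : Perm α} {A B : Finset α} {a b x : α}

theorem Stable.cyc_subset (h : Stable σ A) (hx : x ∈ A) : cyc σ x ⊆ A := by
  intro y hy
  obtain ⟨i, rfl⟩ := mem_cyc_iff_exists_iterate.1 hy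
  induction i with
  | zero => exact hx
  | succ i ih =>
    rw [Function.iterate_succ_apply']
    exact h _ (ih (iterate_mem_cyc σ x i))

theorem Stable.cyc_mem_orb_iff (h : Stable σ A) : cyc σ x ∈ orb σ A ↔ x ∈ A := by
  constructor
  · intro hx
    obtain ⟨y, hy, hxy⟩ := mem_image.1 hx
    exact h.cyc_subset hy (hxy ▸ self_mem_cyc σ x)
  · exact mem_image_of_mem _

theorem Stable.apply_mem_iff (h : Stable σ A) : σ x ∈ A ↔ x ∈ A := by
  refine ⟨fun hx => ?_, h x⟩
  refine h.cyc_subset hx (mem_cyc.2 ?_)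
  exact (Perm.SameCycle.symm (mem_cyc.1 (iterate_mem_cyc σ x 1)))

theorem Stable.sdiff (hA : Stable σ A) (hB : Stable σ B) : Stable σ (A \ B) := by
  intro x hx
  rw [mem_sdiff] at hx ⊢
  rwa [hA.apply_mem_iff, hB.apply_mem_iff]

theorem mem_of_mem_orb (hC : B ∈ orb σ A) : x ∈ B ↔ cyc σ x = B := by
  obtain ⟨y, _, rfl⟩ := mem_image.1 hC
  exact ⟨cyc_eq_of_mem, fun h => h ▸ self_mem_cyc σ x⟩

theorem card_pos_of_mem_orb (hC : B ∈ orb σ A) : 0 < B.card := by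
  obtain ⟨y, _, rfl⟩ := mem_image.1 hC
  exact card_cyc_pos σ y

theorem Stable.sum_cyc (h : Stable σ A) (g : Finset α → ℚ) :
    ∑ x ∈ A, g (cyc σ x) = ∑ C ∈ orb σ A, (C.card : ℚ) * g C := by
  rw [Finset.sum_comp g (cyc σ)]
  refine Finset.sum_congr rfl fun C hC => ?_
  have : A.filter (fun x => cyc σ x = C) = C := by
    ext x
    rw [mem_filter, ← mem_of_mem_orb hC, and_iff_right_iff_imp]
    intro hx
    rw [← h.cyc_mem_orb_iff, (mem_of_mem_orb hC).1 hx]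
    exact hC
  rw [this, nsmul_eq_mul]

theorem Stable.card_eq (h : Stable σ A) : A.card = ∑ C ∈ orb σ A, C.card := by
  have := h.sum_cyc fun _ => 1
  simp only [Finset.sum_const, nsmul_eq_mul, mul_one] at this
  exact_mod_cast this

theorem mem_biUnion_orb {U : Finset (Finset α)} (hU : U ⊆ orb σ A) :
    x ∈ U.biUnion id ↔ cyc σ x ∈ U := by
  simp only [mem_biUnion, id_eq]
  constructor
  · rintro ⟨C, hC, hx⟩
    rwa [(mem_of_mem_orb (hU hC)).1 hx]
  · exact fun hx => ⟨_, hx, self_mem_cyc σ x⟩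

theorem Stable.orb_sdiff (hA : Stable σ A) (hB : Stable σ B) :
    orb σ (A \ B) = orb σ A \ orb σ B := by
  ext C
  constructor
  · intro hC
    obtain ⟨x, hx, rfl⟩ := mem_image.1 hC
    rw [mem_sdiff, hA.cyc_mem_orb_iff, hB.cyc_mem_orb_iff]
    exact mem_sdiff.1 hx
  · intro hC
    obtain ⟨hC1, hC2⟩ := mem_sdiff.1 hC
    obtain ⟨x, hx, rfl⟩ := mem_image.1 hC1
    rw [hB.cyc_mem_orb_iff] at hC2
    exact mem_image_of_mem _ (by simp [hx, hC2])

open Classical in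
theorem Stable.sum_stable_subsets (hA : Stable σ A)
    (g : Finset (Finset α) → Finset (Finset α) → ℚ) :
    ∑ B ∈ A.powerset with (a ∈ B ∧ b ∉ B) ∧ Stable σ B, g (orb σ B) (orb σ (A \ B)) =
      ∑ U ∈ (orb σ A).powerset with cyc σ a ∈ U ∧ cyc σ b ∉ U, g U (orb σ A \ U) := by
  refine Finset.sum_bij' (fun B _ => orb σ B) (fun U _ => U.biUnion id) ?_ ?_ ?_ ?_ ?_
  · intro B hB
    simp only [mem_filter, mem_powerset] at hB ⊢
    obtain ⟨h1, ⟨h2, h3⟩, h4⟩ := hB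
    rw [h4.cyc_mem_orb_iff, h4.cyc_mem_orb_iff]
    exact ⟨image_subset_image h1, h2, h3⟩
  · intro U hU
    simp only [mem_filter, mem_powerset] at hU ⊢
    obtain ⟨h1, h2, h3⟩ := hU
    refine ⟨fun x hx => ?_, ⟨(mem_biUnion_orb h1).2 h2, fun h => h3 ((mem_biUnion_orb h1).1 h)⟩,
      fun x hx => ?_⟩
    · exact hA.cyc_mem_orb_iff.1 (h1 ((mem_biUnion_orb h1).1 hx))
    · rw [mem_biUnion_orb h1] at hx ⊢
      rwa [show cyc σ (σ x) = cyc σ x from cyc_eq_of_mem (iterate_mem_cyc σ x 1)]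
  · intro B hB
    simp only [mem_filter, mem_powerset] at hB
    ext x
    rw [mem_biUnion_orb (show orb σ B ⊆ orb σ A from image_subset_image hB.1), hB.2.2.cyc_mem_orb_iff]
  · intro U hU
    simp only [mem_filter, mem_powerset] at hU
    ext C
    constructor
    · intro hC
      obtain ⟨x, hx, rfl⟩ := mem_image.1 hC
      exact (mem_biUnion_orb hU.1).1 hx
    · intro hC
      obtain ⟨x, hx, rfl⟩ := mem_image.1 (hU.1 hC)
      exact mem_image_of_mem _ ((mem_biUnion_orb hU.1).2 hC)
  · intro B hB
    simp only [mem_filter, mem_powerset] at hB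
    rw [hA.orb_sdiff hB.2.2]

theorem sum_powerset_insert_insert {ι : Type*} [DecidableEq ι] {R : Finset ι} {i j : ι}
    (hij : i ≠ j) (hi : i ∉ R) (hj : j ∉ R) (g : Finset ι → Finset ι → ℚ) :
    ∑ U ∈ (insert i (insert j R)).powerset with i ∈ U ∧ j ∉ U, g U (insert i (insert j R) \ U) =
      ∑ T ∈ R.powerset, g (insert i T) (insert j (R \ T)) := by
  refine (Finset.sum_bij (fun T _ => insert i T) ?_ ?_ ?_ ?_).symm
  · intro T hT
    have hT := mem_powerset.1 hT
    simp only [mem_filter, mem_powerset, mem_insert, true_or, true_and]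
    refine ⟨insert_subset_insert _ (hT.trans (subset_insert _ _)), ?_⟩
    rintro (h | h)
    · exact hij h.symm
    · exact hj (hT h)
  · intro T hT T' hT' h
    rw [← erase_insert (fun h => hi (mem_powerset.1 hT h)), h,
      erase_insert (fun h => hi (mem_powerset.1 hT' h))]
  · intro U hU
    simp only [mem_filter, mem_powerset] at hU
    refine ⟨U.erase i, ?_, insert_erase hU.2.1⟩
    rw [mem_powerset]
    intro x hx
    obtain ⟨h1, h2⟩ := mem_erase.1 hx
    have := hU.1 h2
    simp only [mem_insert] at this
    rcases this with h | h | h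
    · exact absurd h h1
    · exact absurd (h ▸ h2) hU.2.2
    · exact h
  · intro T hT
    have hT := mem_powerset.1 hT
    congr 1
    ext x
    simp only [mem_insert, mem_sdiff, not_or]
    constructor
    · rintro (rfl | ⟨h1, h2⟩)
      · exact ⟨Or.inr (Or.inl rfl), hij.symm, fun h => hj (hT h)⟩
      · exact ⟨Or.inr (Or.inr h1), fun h => hi (h ▸ h1), h2⟩
    · rintro ⟨h1 | h1 | h1, h2, h3⟩
      · exact absurd h1 h2
      · exact Or.inl h1
      · exact Or.inr ⟨h1, h3⟩

omit [Fintype α] in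
theorem Stable.swap_mul (hA : Stable σ A) (ha : a ∈ A) (hb : b ∈ A) :
    Stable (swap a b * σ) A := by
  intro x hx
  rw [Perm.mul_apply, swap_apply_def]
  split_ifs
  · exact hb
  · exact ha
  · exact hA x hx

theorem Stable.orb_swap_of_mem (hA : Stable σ A) (ha : a ∈ A) (hab : a ≠ b) (hb : b ∈ cyc σ a) :
    orb (swap a b * σ) A = insert (cyc (swap a b * σ) a) (insert (cyc (swap a b * σ) b)
      ((orb σ A).erase (cyc σ a))) := by
  have hbA : b ∈ A := hA.cyc_subset ha hb
  have hu := cyc_swap_union_of_mem hab hb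
  have key : ∀ x, x ∉ cyc σ a → cyc (swap a b * σ) x = cyc σ x := by
    intro x hx
    refine cyc_swap_mul_of_not_mem (fun h => hx ?_) (fun h => hx ?_)
    · exact cyc_eq_of_mem h ▸ self_mem_cyc σ x
    · rw [← cyc_eq_of_mem hb]
      exact cyc_eq_of_mem h ▸ self_mem_cyc σ x
  ext C
  simp only [mem_insert, mem_erase]
  constructor
  · intro hC
    obtain ⟨x, hx, rfl⟩ := mem_image.1 hC
    by_cases hxa : x ∈ cyc σ a
    · rw [← hu, mem_union] at hxa
      rcases hxa with h | h
      · exact Or.inl (cyc_eq_of_mem h)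
      · exact Or.inr (Or.inl (cyc_eq_of_mem h))
    · rw [key x hxa]
      refine Or.inr (Or.inr ⟨fun h => hxa (h ▸ self_mem_cyc σ x), mem_image_of_mem _ hx⟩)
  · rintro (rfl | rfl | ⟨h1, h2⟩)
    · exact mem_image_of_mem _ ha
    · exact mem_image_of_mem _ hbA
    · obtain ⟨x, hx, rfl⟩ := mem_image.1 h2
      rw [← key x fun h => h1 (cyc_eq_of_mem h)]
      exact mem_image_of_mem _ hx

theorem cyc_not_mem_erase_of_subset {τ : Perm α} (h : cyc τ x ⊆ cyc σ a) :
    cyc τ x ∉ (orb σ A).erase (cyc σ a) := by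
  intro hC
  obtain ⟨h1, h2⟩ := mem_erase.1 hC
  have h3 := self_mem_cyc τ x
  have h4 := (mem_of_mem_orb h2).1 h3
  exact h1 (h4 ▸ cyc_eq_of_mem (h h3))

theorem orb_swap_of_not_mem (ha : a ∈ A)
    (hb : b ∉ cyc σ a) : orb (swap a b * σ) A = insert (cyc σ a ∪ cyc σ b)
      (((orb σ A).erase (cyc σ a)).erase (cyc σ b)) := by
  have key : ∀ x, x ∉ cyc σ a → x ∉ cyc σ b → cyc (swap a b * σ) x = cyc σ x := by
    intro x hx hx'
    refine cyc_swap_mul_of_not_mem (fun h => hx ?_) (fun h => hx' ?_)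
    · exact cyc_eq_of_mem h ▸ self_mem_cyc σ x
    · exact cyc_eq_of_mem h ▸ self_mem_cyc σ x
  have hu := cyc_swap_of_not_mem hb
  ext C
  simp only [mem_insert, mem_erase]
  constructor
  · intro hC
    obtain ⟨x, hx, rfl⟩ := mem_image.1 hC
    by_cases hxa : x ∈ cyc σ a ∪ cyc σ b
    · left
      rw [← hu] at hxa ⊢
      exact cyc_eq_of_mem hxa
    · simp only [mem_union, not_or] at hxa
      rw [key x hxa.1 hxa.2]
      refine Or.inr ⟨fun h => hxa.2 (h ▸ self_mem_cyc σ x), fun h => hxa.1 (h ▸ self_mem_cyc σ x),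
        mem_image_of_mem _ hx⟩
  · rintro (rfl | ⟨h1, h2, h3⟩)
    · rw [← hu]
      exact mem_image_of_mem _ ha
    · obtain ⟨x, hx, rfl⟩ := mem_image.1 h3
      rw [← key x (fun h => h2 (cyc_eq_of_mem h)) (fun h => h1 (cyc_eq_of_mem h))]
      exact mem_image_of_mem _ hx

theorem union_not_mem_erase (A : Finset α) : cyc σ a ∪ cyc σ b ∉
    (((orb σ A).erase (cyc σ a)).erase (cyc σ b)) := by
  intro hC
  obtain ⟨_, h⟩ := mem_erase.1 hC
  obtain ⟨h1, h2⟩ := mem_erase.1 h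
  exact h1 (((mem_of_mem_orb h2).1 (mem_union_left _ (self_mem_cyc σ a))).symm)

end Orbits

section Count

open Equiv

variable {α : Type*} [Fintype α] [DecidableEq α]

/-- The cardinality of a nonempty set. -/
def len (C : Finset α) : ℕ := max 1 C.card

omit [Fintype α] [DecidableEq α] in
theorem len_ne_zero (C : Finset α) : len C ≠ 0 := by unfold len; omega

omit [Fintype α] [DecidableEq α] in
theorem len_eq {C : Finset α} (h : 0 < C.card) : len C = C.card := by unfold len; omega

/-- The number of minimal transitive factorizations of a permutation with set of cycles `U`,
divided by the factorial of their length. -/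
def hur (U : Finset (Finset α)) : ℚ :=
  ((∑ C ∈ U, len C : ℕ) : ℚ) ^ ((U.card : ℤ) - 3) * ∏ C ∈ U, weight (len C)

omit [Fintype α] in
theorem hur_insert {C : Finset α} {T : Finset (Finset α)} (hC : C ∉ T) :
    hur (insert C T) = weight (len C) *
      (abelD (fun C : Finset α => (len C : ℚ)) (len C) T * ∏ k ∈ T, weight (len k)) := by
  rw [hur, abelD, Finset.sum_insert hC, Finset.prod_insert hC, Finset.card_insert_of_notMem hC,
    show (((T.card + 1 : ℕ) : ℤ) - 3) = T.card - 2 by push_cast; ring]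
  push_cast
  ring

variable {σ : Perm α} {A B : Finset α} {a b x : α}

theorem Stable.sum_len (h : Stable σ A) : ∑ C ∈ orb σ A, len C = A.card := by
  rw [h.card_eq]
  exact Finset.sum_congr rfl fun C hC => len_eq (card_pos_of_mem_orb hC)

theorem card_orb_pos (hA : A.Nonempty) : 0 < (orb σ A).card := (hA.image _).card_pos

/-- The value of `cnt A m σ` for words of at most the minimal length. -/
def CountFormula (A : Finset α) (σ : Perm α) (m : ℕ) : Prop :=
  (m + 2 < A.card + (orb σ A).card → cnt A m σ = 0) ∧
    (m + 2 = A.card + (orb σ A).card → cnt A m σ = (m.factorial : ℚ) * hur (orb σ A))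

theorem countFormula_zero (hA : A.Nonempty) (hσ : Stable σ A) : CountFormula A σ 0 := by
  classical
  have h1 := hA.card_pos
  have h2 := card_orb_pos (σ := σ) hA
  have hrel : ∀ x y : α, Rel ([] : List (Perm α)) x y ↔ x = y := by
    intro x y
    refine ⟨fun h => ?_, fun h => h ▸ rel_refl _ _⟩
    have := (h {x} (by simp [Invariant])).1 rfl
    exact this.symm
  have hfac : Fac A σ [] ↔ A.card = 1 := by
    constructor
    · intro h
      refine le_antisymm (Finset.card_le_one.2 fun x hx y hy => ?_) h1
      exact (hrel x y).1 (h.1.2 x hx y hy)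
    · intro h
      obtain ⟨x, rfl⟩ := Finset.card_eq_one.1 h
      have := hσ x (mem_singleton_self x)
      rw [mem_singleton] at this
      refine ⟨⟨by simp, ?_⟩, ?_⟩
      · simp [hrel]
      · simp [this]
  have hcnt : cnt A 0 σ = if A.card = 1 then 1 else 0 := by
    rw [cnt, wordSum]
    exact if_congr hfac rfl rfl
  constructor
  · intro h
    rw [hcnt, if_neg]
    intro h3
    have : (orb σ A).card ≤ A.card := card_image_le
    omega
  · intro h
    have h3 : A.card = 1 := by omega
    have h4 : (orb σ A).card = 1 := by omega
    obtain ⟨C, hC⟩ := Finset.card_eq_one.1 h4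
    have h5 := hσ.sum_len
    rw [hC, Finset.sum_singleton, h3] at h5
    rw [hcnt, if_pos h3, hur, hC]
    simp [h5, weight, treeV]

open Classical in
theorem sum_split {m : ℕ} (IH : ∀ i ≤ m, ∀ (B : Finset α) (τ : Perm α), B.Nonempty → Stable τ B →
    CountFormula B τ i) (hA : Stable σ A) (hb : b ∈ A) :
    (m + 4 < A.card + (orb σ A).card →
      ∑ B ∈ A.powerset with a ∈ B ∧ b ∉ B, ∑ ij ∈ antidiagonal m,
        (m.choose ij.1 : ℚ) * (cnt B ij.1 σ * cnt (A \ B) ij.2 σ) = 0) ∧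
    (m + 4 = A.card + (orb σ A).card →
      ∑ B ∈ A.powerset with a ∈ B ∧ b ∉ B, ∑ ij ∈ antidiagonal m,
        (m.choose ij.1 : ℚ) * (cnt B ij.1 σ * cnt (A \ B) ij.2 σ) =
      (m.factorial : ℚ) * ∑ U ∈ (orb σ A).powerset with cyc σ a ∈ U ∧ cyc σ b ∉ U,
        hur U * hur (orb σ A \ U)) := by
  have h0 : ∀ B, ¬ Stable σ B → ∑ ij ∈ antidiagonal m,
        (m.choose ij.1 : ℚ) * (cnt B ij.1 σ * cnt (A \ B) ij.2 σ) = 0 := by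
    intro B hB
    simp only [Stable, not_forall] at hB
    obtain ⟨x, hx, hx'⟩ := hB
    exact Finset.sum_eq_zero fun ij _ => by rw [cnt_eq_zero_of_not_mem hx hx']; ring
  have hsum : ∑ B ∈ A.powerset with a ∈ B ∧ b ∉ B, ∑ ij ∈ antidiagonal m,
        (m.choose ij.1 : ℚ) * (cnt B ij.1 σ * cnt (A \ B) ij.2 σ) =
      ∑ B ∈ A.powerset with (a ∈ B ∧ b ∉ B) ∧ Stable σ B, ∑ ij ∈ antidiagonal m,
        (m.choose ij.1 : ℚ) * (cnt B ij.1 σ * cnt (A \ B) ij.2 σ) := by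
    rw [Finset.sum_filter, Finset.sum_filter]
    refine Finset.sum_congr rfl fun B _ => ?_
    by_cases hB : Stable σ B
    · simp only [hB, and_true]
    · simp only [hB, and_false, h0 B hB, ite_self]
  have hdata : ∀ B ∈ A.powerset.filter (fun B => (a ∈ B ∧ b ∉ B) ∧ Stable σ B),
      B.Nonempty ∧ (A \ B).Nonempty ∧ Stable σ B ∧ Stable σ (A \ B) ∧
      B.card + (A \ B).card = A.card ∧
      (orb σ B).card + (orb σ (A \ B)).card = (orb σ A).card := by
    intro B hB
    simp only [mem_filter, mem_powerset] at hB
    obtain ⟨h1, ⟨h2, h3⟩, h4⟩ := hB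
    refine ⟨⟨a, h2⟩, ⟨b, mem_sdiff.2 ⟨hb, h3⟩⟩, h4, hA.sdiff h4, ?_, ?_⟩
    · rw [add_comm]; exact Finset.card_sdiff_add_card_eq_card h1
    · rw [hA.orb_sdiff h4, add_comm]
      exact Finset.card_sdiff_add_card_eq_card (image_subset_image h1)
  constructor
  · intro hm
    rw [hsum]
    refine Finset.sum_eq_zero fun B hB => Finset.sum_eq_zero fun ij hij => ?_
    obtain ⟨h1, h2, h3, h4, h5, h6⟩ := hdata B hB
    have hij := HasAntidiagonal.mem_antidiagonal.1 hij
    by_cases hi : ij.1 + 2 < B.card + (orb σ B).card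
    · rw [(IH ij.1 (by omega) B σ h1 h3).1 hi]; ring
    · rw [(IH ij.2 (by omega) (A \ B) σ h2 h4).1 (by omega)]; ring
  · intro hm
    rw [hsum, ← hA.sum_stable_subsets fun U V => hur U * hur V, Finset.mul_sum]
    refine Finset.sum_congr rfl fun B hB => ?_
    obtain ⟨h1, h2, h3, h4, h5, h6⟩ := hdata B hB
    have h7 := h1.card_pos
    have h8 := card_orb_pos (σ := σ) h1
    have h9 := h2.card_pos
    have h10 := card_orb_pos (σ := σ) h2
    obtain ⟨i, hi⟩ : ∃ i, i + 2 = B.card + (orb σ B).card :=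
      ⟨B.card + (orb σ B).card - 2, by omega⟩
    obtain ⟨j, hj⟩ : ∃ j, j + 2 = (A \ B).card + (orb σ (A \ B)).card :=
      ⟨(A \ B).card + (orb σ (A \ B)).card - 2, by omega⟩
    have hij : i + j = m := by omega
    rw [Finset.sum_eq_single (i, j), (IH i (by omega) B σ h1 h3).2 hi,
      (IH j (by omega) (A \ B) σ h2 h4).2 hj, ← hij, ← Nat.add_choose_mul_factorial_mul_factorial,
      Nat.choose_symm_add]
    · push_cast
      ring
    · intro kl hkl hne
      have hkl := HasAntidiagonal.mem_antidiagonal.1 hkl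
      by_cases hk : kl.1 + 2 < B.card + (orb σ B).card
      · rw [(IH kl.1 (by omega) B σ h1 h3).1 hk]; ring
      · have : kl.2 + 2 ≠ (A \ B).card + (orb σ (A \ B)).card := fun h =>
          hne (Prod.ext (by simp only; omega) (by simp only; omega))
        rw [(IH kl.2 (by omega) (A \ B) σ h2 h4).1 (by omega)]; ring
    · intro h
      exact absurd (HasAntidiagonal.mem_antidiagonal.2 hij) h

/-- The contribution of cutting a cycle `C` into cycles of lengths `p.1` and `p.2`. -/
def cutTerm (P : Finset (Finset α)) (C : Finset α) (p : ℕ × ℕ) : ℚ :=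
  weight p.1 * weight p.2 * ∑ T ∈ (P.erase C).powerset,
    (abelD (fun C : Finset α => (len C : ℚ)) p.1 T * ∏ k ∈ T, weight (len k)) *
    (abelD (fun C : Finset α => (len C : ℚ)) p.2 (P.erase C \ T) *
      ∏ k ∈ P.erase C \ T, weight (len k))

/-- The contribution of joining the cycles `C` and `D`. -/
def joinTerm (n : ℕ) (P : Finset (Finset α)) (C D : Finset α) : ℚ :=
  (n : ℚ) ^ ((P.card : ℤ) - 4) *
    (weight (len C + len D) * ∏ k ∈ (P.erase C).erase D, weight (len k))

open Classical in
theorem summand_of_mem {m : ℕ} (IH : ∀ i ≤ m, ∀ (B : Finset α) (τ : Perm α), B.Nonempty →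
    Stable τ B → CountFormula B τ i) (hA : Stable σ A) (ha : a ∈ A) (hab : a ≠ b)
    (hb : b ∈ cyc σ a) :
    (m + 3 < A.card + (orb σ A).card → cnt A m (swap a b * σ) +
      ∑ B ∈ A.powerset with a ∈ B ∧ b ∉ B, ∑ ij ∈ antidiagonal m,
        (m.choose ij.1 : ℚ) * (cnt B ij.1 (swap a b * σ) * cnt (A \ B) ij.2 (swap a b * σ)) = 0) ∧
    (m + 3 = A.card + (orb σ A).card → cnt A m (swap a b * σ) +
      ∑ B ∈ A.powerset with a ∈ B ∧ b ∉ B, ∑ ij ∈ antidiagonal m,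
        (m.choose ij.1 : ℚ) * (cnt B ij.1 (swap a b * σ) * cnt (A \ B) ij.2 (swap a b * σ)) =
      (m.factorial : ℚ) * cutTerm (orb σ A) (cyc σ a)
        ((cyc (swap a b * σ) a).card, (cyc (swap a b * σ) b).card)) := by
  have hbA := hA.cyc_subset ha hb
  have hA' := hA.swap_mul ha hbA
  have horb := hA.orb_swap_of_mem ha hab hb
  have hu := cyc_swap_union_of_mem hab hb
  have h1 : cyc (swap a b * σ) a ∉ (orb σ A).erase (cyc σ a) :=
    cyc_not_mem_erase_of_subset (hu ▸ subset_union_left)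
  have h2 : cyc (swap a b * σ) b ∉ (orb σ A).erase (cyc σ a) :=
    cyc_not_mem_erase_of_subset (hu ▸ subset_union_right)
  have h3 : cyc (swap a b * σ) a ≠ cyc (swap a b * σ) b := by
    intro h
    exact not_mem_cyc_swap_of_mem hab hb (h ▸ self_mem_cyc _ _)
  have hcard : (orb (swap a b * σ) A).card = (orb σ A).card + 1 := by
    rw [horb, card_insert_of_notMem (by simp only [mem_insert, not_or]; exact ⟨h3, h1⟩),
      card_insert_of_notMem h2,
      card_erase_add_one (show cyc σ a ∈ orb σ A from mem_image_of_mem _ ha)]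
  obtain ⟨hs1, hs2⟩ := sum_split (a := a) IH hA' hbA
  have hz := (IH m le_rfl A (swap a b * σ) ⟨a, ha⟩ hA').1
  rw [hcard] at hs1 hs2 hz
  constructor
  · intro hm
    rw [hz (by omega), hs1 (by omega), add_zero]
  · intro hm
    rw [hz (by omega), hs2 (by omega), zero_add, horb,
      sum_powerset_insert_insert h3 h1 h2 fun U V => hur U * hur V, cutTerm]
    congr 1
    rw [Finset.mul_sum]
    refine Finset.sum_congr rfl fun T hT => ?_
    have hT := mem_powerset.1 hT
    rw [hur_insert fun h => h1 (hT h), hur_insert fun h => h2 (sdiff_subset h),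
      len_eq (card_cyc_pos _ a), len_eq (card_cyc_pos _ b)]
    ring

open Classical in
theorem summand_of_not_mem {m : ℕ} (IH : ∀ i ≤ m, ∀ (B : Finset α) (τ : Perm α), B.Nonempty →
    Stable τ B → CountFormula B τ i) (hA : Stable σ A) (ha : a ∈ A) (hbA : b ∈ A)
    (hb : b ∉ cyc σ a) :
    (m + 3 < A.card + (orb σ A).card → cnt A m (swap a b * σ) +
      ∑ B ∈ A.powerset with a ∈ B ∧ b ∉ B, ∑ ij ∈ antidiagonal m,
        (m.choose ij.1 : ℚ) * (cnt B ij.1 (swap a b * σ) * cnt (A \ B) ij.2 (swap a b * σ)) = 0) ∧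
    (m + 3 = A.card + (orb σ A).card → cnt A m (swap a b * σ) +
      ∑ B ∈ A.powerset with a ∈ B ∧ b ∉ B, ∑ ij ∈ antidiagonal m,
        (m.choose ij.1 : ℚ) * (cnt B ij.1 (swap a b * σ) * cnt (A \ B) ij.2 (swap a b * σ)) =
      (m.factorial : ℚ) * joinTerm A.card (orb σ A) (cyc σ a) (cyc σ b)) := by
  have hA' := hA.swap_mul ha hbA
  have horb := orb_swap_of_not_mem ha hb
  have hnot := union_not_mem_erase (σ := σ) (a := a) (b := b) A
  have haO : cyc σ a ∈ orb σ A := mem_image_of_mem _ ha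
  have hbO : cyc σ b ∈ (orb σ A).erase (cyc σ a) :=
    mem_erase.2 ⟨fun h => hb (h ▸ self_mem_cyc σ b), mem_image_of_mem _ hbA⟩
  have hcard : (orb (swap a b * σ) A).card + 1 = (orb σ A).card := by
    rw [horb, card_insert_of_notMem hnot, card_erase_add_one hbO, card_erase_add_one haO]
  have hsplit : ∑ B ∈ A.powerset with a ∈ B ∧ b ∉ B, ∑ ij ∈ antidiagonal m,
        (m.choose ij.1 : ℚ) * (cnt B ij.1 (swap a b * σ) * cnt (A \ B) ij.2 (swap a b * σ)) = 0 := by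
    refine Finset.sum_eq_zero fun B hB => Finset.sum_eq_zero fun ij _ => ?_
    simp only [mem_filter, mem_powerset] at hB
    have : ¬ Stable (swap a b * σ) B := fun h =>
      hB.2.2 (h.cyc_subset hB.2.1 (mem_cyc_swap_of_not_mem hb))
    simp only [Stable, not_forall] at this
    obtain ⟨x, hx, hx'⟩ := this
    rw [cnt_eq_zero_of_not_mem hx hx']; ring
  obtain ⟨hz1, hz2⟩ := IH m le_rfl A (swap a b * σ) ⟨a, ha⟩ hA'
  rw [hsplit, add_zero]
  refine ⟨fun hm => hz1 (by omega), fun hm => ?_⟩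
  rw [hz2 (by omega), hur, hA'.sum_len, joinTerm, ← hcard, horb, Finset.prod_insert hnot]
  have hlen : len (cyc σ a ∪ cyc σ b) = len (cyc σ a) + len (cyc σ b) := by
    have h1 := card_cyc_pos σ a
    have h2 := card_cyc_pos σ b
    rw [len_eq h1, len_eq h2, len_eq, card_union_of_disjoint (disjoint_cyc hb)]
    rw [card_union_of_disjoint (disjoint_cyc hb)]; omega
  rw [hlen]
  congr 3
  push_cast
  ring

theorem sum_cutTerm (P : Finset (Finset α)) (σ : Perm α) (a : α) :
    ∑ b ∈ (cyc σ a).erase a, cutTerm P (cyc σ a)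
        ((cyc (swap a b * σ) a).card, (cyc (swap a b * σ) b).card) =
      ∑ p ∈ antidiagonal (cyc σ a).card, cutTerm P (cyc σ a) p := by
  have hk := card_cyc_pos σ a
  have hw : weight 0 = 0 := by simp [weight]
  rw [sum_antidiagonal_eq_interior hk.ne', cutTerm, cutTerm]
  simp only [hw, zero_mul, mul_zero, zero_add]
  refine (Finset.sum_bij (fun p _ => σ^[p.1] a) ?_ ?_ ?_ ?_).symm
  · intro p hp
    obtain ⟨h, h1, h2⟩ := mem_interior.1 hp
    refine mem_erase.2 ⟨fun h3 => h1 ?_, iterate_mem_cyc σ a _⟩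
    exact (iterate_eq_iterate_iff (σ := σ) (a := a) (i := p.1) (j := 0) (by omega) hk).1 h3
  · intro p hp q hq h
    obtain ⟨h0, h1, h2⟩ := mem_interior.1 hp
    obtain ⟨h3, h4, h5⟩ := mem_interior.1 hq
    have := (iterate_eq_iterate_iff (by omega) (by omega)).1 h
    exact Prod.ext this (by omega)
  · intro b hb
    obtain ⟨h1, h2⟩ := mem_erase.1 hb
    obtain ⟨p, hp, hpk, h⟩ := exists_iterate_of_mem_cyc h1.symm h2
    exact ⟨(p, (cyc σ a).card - p), mem_interior.2 (by simp only; omega), h⟩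
  · intro p hp
    obtain ⟨h, h1, h2⟩ := mem_interior.1 hp
    have h3 : 0 < p.1 := Nat.pos_of_ne_zero h1
    have h4 : p.1 < (cyc σ a).card := by omega
    have h5 := card_cyc_swap_iterate_left h3 h4
    have h6 := cyc_swap_iterate_union h3 h4
    have h7 := disjoint_cyc (iterate_not_mem_cyc_swap h3 h4)
    have h8 := card_union_of_disjoint h7
    rw [h6, h5] at h8
    congr 1
    exact Prod.ext h5.symm (by simp only; omega)

theorem sum_joinTerm (hA : Stable σ A) (n : ℕ) (a : α) :
    ∑ b ∈ A with b ∉ cyc σ a, joinTerm n (orb σ A) (cyc σ a) (cyc σ b) =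
      ∑ D ∈ (orb σ A).erase (cyc σ a), (len D : ℚ) * joinTerm n (orb σ A) (cyc σ a) D := by
  have h : ∀ b, b ∉ cyc σ a ↔ cyc σ b ≠ cyc σ a := fun b =>
    not_congr ⟨cyc_eq_of_mem, fun h => h ▸ self_mem_cyc σ b⟩
  simp only [h]
  rw [Finset.sum_filter, hA.sum_cyc fun D =>
    if D ≠ cyc σ a then joinTerm n (orb σ A) (cyc σ a) D else 0]
  simp only [mul_ite, mul_zero]
  rw [← Finset.sum_filter, Finset.filter_ne']
  refine Finset.sum_congr rfl fun D hD => ?_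
  rw [len_eq (card_pos_of_mem_orb (mem_of_mem_erase hD))]

theorem countFormula_succ {m : ℕ} (IH : ∀ i ≤ m, ∀ (B : Finset α) (τ : Perm α), B.Nonempty →
    Stable τ B → CountFormula B τ i) (hne : A.Nonempty) (hA : Stable σ A) :
    CountFormula A σ (m + 1) := by
  classical
  constructor
  · intro hm
    have : 2 * cnt A (m + 1) σ = 0 := by
      rw [two_mul_cnt_succ]
      refine Finset.sum_eq_zero fun a ha => Finset.sum_eq_zero fun b hb => ?_
      obtain ⟨h1, h2⟩ := mem_erase.1 hb
      by_cases h : b ∈ cyc σ a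
      · exact (summand_of_mem IH hA ha h1.symm h).1 (by omega)
      · exact (summand_of_not_mem IH hA ha h2 h).1 (by omega)
    linarith
  · intro hm
    have h : 2 * cnt A (m + 1) σ = (m.factorial : ℚ) *
        (∑ C ∈ orb σ A, ∑ D ∈ (orb σ A).erase C, (len C : ℚ) * len D *
            joinTerm A.card (orb σ A) C D +
          ∑ C ∈ orb σ A, (len C : ℚ) * ∑ p ∈ antidiagonal (len C), cutTerm (orb σ A) C p) := by
      have h1 : ∀ a ∈ A, ∑ b ∈ A.erase a, (cnt A m (swap a b * σ) +
          ∑ B ∈ A.powerset with a ∈ B ∧ b ∉ B, ∑ ij ∈ antidiagonal m, (m.choose ij.1 : ℚ) *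
            (cnt B ij.1 (swap a b * σ) * cnt (A \ B) ij.2 (swap a b * σ))) =
          (m.factorial : ℚ) * (∑ D ∈ (orb σ A).erase (cyc σ a),
              (len D : ℚ) * joinTerm A.card (orb σ A) (cyc σ a) D +
            ∑ p ∈ antidiagonal (cyc σ a).card, cutTerm (orb σ A) (cyc σ a) p) := by
        intro a ha
        rw [← sum_joinTerm hA, ← sum_cutTerm, mul_add, Finset.mul_sum, Finset.mul_sum,
          ← Finset.sum_filter_add_sum_filter_not (A.erase a) (fun b => b ∉ cyc σ a)]
        have e1 : (A.erase a).filter (fun b => b ∉ cyc σ a) = A.filter fun b => b ∉ cyc σ a := by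
          ext b
          simp only [mem_filter, mem_erase]
          refine ⟨fun h => ⟨h.1.2, h.2⟩, fun h => ⟨⟨?_, h.1⟩, h.2⟩⟩
          rintro rfl
          exact h.2 (self_mem_cyc σ b)
        have e2 : (A.erase a).filter (fun b => ¬ b ∉ cyc σ a) = (cyc σ a).erase a := by
          ext b
          simp only [mem_filter, mem_erase, not_not]
          exact ⟨fun h => ⟨h.1.1, h.2⟩, fun h => ⟨⟨h.1, hA.cyc_subset ha h.2⟩, h.2⟩⟩
        rw [e1, e2]
        congr 1
        · refine Finset.sum_congr rfl fun b hb => ?_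
          obtain ⟨h1, h2⟩ := mem_filter.1 hb
          rw [← (summand_of_not_mem IH hA ha h1 h2).2 (by omega)]
        · refine Finset.sum_congr rfl fun b hb => ?_
          obtain ⟨h1, h2⟩ := mem_erase.1 hb
          rw [← (summand_of_mem IH hA ha h1.symm h2).2 (by omega)]
      rw [two_mul_cnt_succ, Finset.sum_congr rfl h1, ← Finset.mul_sum, hA.sum_cyc fun C =>
        ∑ D ∈ (orb σ A).erase C, (len D : ℚ) * joinTerm A.card (orb σ A) C D +
            ∑ p ∈ antidiagonal C.card, cutTerm (orb σ A) C p, ← Finset.sum_add_distrib]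
      congr 1
      refine Finset.sum_congr rfl fun C hC => ?_
      rw [len_eq (card_pos_of_mem_orb hC), mul_add, Finset.mul_sum]
      congr 1
      exact Finset.sum_congr rfl fun D _ => by ring
    have hid := cut_join_identity (c := (len : Finset α → ℕ)) len_ne_zero (orb σ A)
      (hne.image _) hA.sum_len.symm
    have hm' : (A.card : ℚ) + (orb σ A).card - 2 = m + 1 := by
      have : ((m + 1 + 2 : ℕ) : ℚ) = (A.card + (orb σ A).card : ℕ) := by rw [hm]
      push_cast at this
      linarith
    rw [hm'] at hid
    rw [hur, hA.sum_len, Nat.factorial_succ]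
    simp only [joinTerm, cutTerm] at h
    push_cast
    linear_combination (1 / 2 : ℚ) * h - (m.factorial : ℚ) * hid

theorem countFormula (m : ℕ) (A : Finset α) (σ : Perm α) (hne : A.Nonempty) (hA : Stable σ A) :
    CountFormula A σ m := by
  induction m using Nat.strong_induction_on generalizing A σ with
  | _ m ih =>
    cases m with
    | zero => exact countFormula_zero hne hA
    | succ m => exact countFormula_succ (fun i hi => ih i (by omega)) hne hA

end Count

section Partition

open Equiv

variable {α : Type*} [Fintype α] [DecidableEq α]

theorem orb_univ_eq_union (σ : Perm α) :
    orb σ univ = σ.cycleFactorsFinset.image Perm.support ∪ σ.supportᶜ.image singleton := by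
  have h : ∀ x, σ x ≠ x → (σ.cycleOf x).support = cyc σ x := by
    intro x hx
    ext y
    rw [Perm.mem_support_cycleOf_iff, mem_cyc, Perm.mem_support]
    exact and_iff_left hx
  have h' : ∀ x, σ x = x → cyc σ x = {x} := by
    intro x hx
    rw [cyc_eq_image_range (k := 1) one_pos (by simpa using hx)]
    simp
  ext C
  simp only [orb, mem_image, mem_union, mem_univ, true_and, mem_compl, Perm.mem_support, not_not]
  constructor
  · rintro ⟨x, rfl⟩
    by_cases hx : σ x = x
    · exact Or.inr ⟨x, hx, (h' x hx).symm⟩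
    · refine Or.inl ⟨σ.cycleOf x, ?_, h x hx⟩
      rw [Perm.cycleOf_mem_cycleFactorsFinset_iff, Perm.mem_support]
      exact hx
  · rintro (⟨c, hc, rfl⟩ | ⟨x, hx, rfl⟩)
    · obtain ⟨x, hx⟩ := (Perm.mem_cycleFactorsFinset_iff.1 hc).1.nonempty_support
      rw [Perm.cycle_is_cycleOf hx hc]
      refine ⟨x, (h x ?_).symm⟩
      exact Perm.mem_support.1 (Perm.mem_cycleFactorsFinset_support_le hc hx)
    · exact ⟨x, h' x hx⟩

theorem map_card_orb_univ (σ : Perm α) :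
    (orb σ univ).val.map Finset.card = σ.partition.parts := by
  have hdisj : Disjoint (σ.cycleFactorsFinset.image Perm.support)
      (σ.supportᶜ.image (singleton : α → Finset α)) := by
    rw [Finset.disjoint_left]
    intro C h1 h2
    obtain ⟨c, hc, rfl⟩ := mem_image.1 h1
    obtain ⟨x, hx, h⟩ := mem_image.1 h2
    have := (Perm.mem_cycleFactorsFinset_iff.1 hc).1.two_le_card_support
    rw [← h, card_singleton] at this
    omega
  have hinj : Set.InjOn Perm.support (σ.cycleFactorsFinset : Set (Perm α)) := by
    intro c hc d hd h
    obtain ⟨x, hx⟩ := (Perm.mem_cycleFactorsFinset_iff.1 hc).1.nonempty_support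
    rw [Perm.cycle_is_cycleOf hx hc, Perm.cycle_is_cycleOf (h ▸ hx) hd]
  rw [orb_univ_eq_union, ← Finset.disjUnion_eq_union _ _ hdisj, Finset.disjUnion_val,
    Multiset.map_add, Finset.image_val_of_injOn hinj,
    Finset.image_val_of_injOn (Finset.singleton_injective.injOn), Multiset.map_map,
    Multiset.map_map, Perm.parts_partition, Perm.cycleType_def]
  congr 1
  simp only [Function.comp_def, card_singleton, Multiset.map_const', Finset.card_val,
    Finset.card_compl]

end Partition

theorem weight_eq {a : ℕ} (ha : 0 < a) :
    weight a = (a : ℚ) ^ a / ((a - 1).factorial : ℚ) := by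
  obtain ⟨k, rfl⟩ := Nat.exists_eq_succ_of_ne_zero ha.ne'
  have : (k.factorial : ℚ) ≠ 0 := by exact_mod_cast k.factorial_ne_zero
  rw [weight, treeV, Nat.factorial_succ, Nat.succ_sub_one]
  push_cast
  field_simp

theorem hur_orb_univ {α : Type*} [Fintype α] [DecidableEq α] (σ : Equiv.Perm α) :
    hur (orb σ univ) = (Fintype.card α : ℚ) ^ ((σ.partition.parts.card : ℤ) - 3) *
      (σ.partition.parts.map fun a : ℕ => (a : ℚ) ^ a / ((a - 1).factorial : ℚ)).prod := by
  rw [hur, Stable.sum_len (fun _ _ => mem_univ _), ← map_card_orb_univ, Multiset.card_map,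
    Multiset.map_map, Finset.card_univ]
  congr 1
  refine Finset.prod_congr rfl fun C hC => ?_
  have h := card_pos_of_mem_orb hC
  rw [len_eq h, weight_eq h]
  rfl

theorem fac_univ_ofFn_iff {n m : ℕ} (σ : Equiv.Perm (Fin n)) (f : Fin m → Equiv.Perm (Fin n)) :
    Fac univ σ (List.ofFn f) ↔ (List.ofFn f).prod = σ ∧ (∀ i, (f i).IsSwap) ∧
        ∀ a b : Fin n, ∃ g ∈ Subgroup.closure (Set.range f), g a = b := by
  have h : {e | e ∈ List.ofFn f} = Set.range f := by
    ext e
    simp [List.mem_ofFn]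
  simp only [Fac, Conn, Letter, rel_iff_exists_closure, h, mem_univ, true_imp_iff,
    List.forall_mem_ofFn_iff, subset_univ, and_true]
  rw [← Equiv.ext_iff, and_comm]

end Hurwitz

/-- Genus-0 Hurwitz number formula: for `σ ∈ S_n` with full cycle type `α` (fixed points
included) having `ℓ` parts, and `m = n + ℓ - 2`, the number of transitive factorizations
of `σ` into `m` transpositions equals `m! · n^{ℓ-3} · ∏_j α_j^{α_j} / (α_j - 1)!`. -/
theorem stmt3 (n : ℕ) (hn : 1 ≤ n) (σ : Equiv.Perm (Fin n))
    (ℓ : ℕ) (hℓ : ℓ = σ.partition.parts.card)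
    (m : ℕ) (hm : m = n + ℓ - 2) :
    (Nat.card {f : Fin m → Equiv.Perm (Fin n) //
        (List.ofFn f).prod = σ ∧ (∀ i, (f i).IsSwap) ∧
        ∀ a b : Fin n, ∃ g ∈ Subgroup.closure (Set.range f), g a = b} : ℚ) =
      (m.factorial : ℚ) * (n : ℚ) ^ ((ℓ : ℤ) - 3) *
        (σ.partition.parts.map
          (fun a : ℕ => (a : ℚ) ^ a / ((a - 1).factorial : ℚ))).prod := by
  classical
  have hne : (Finset.univ : Finset (Fin n)).Nonempty := ⟨⟨0, hn⟩, Finset.mem_univ _⟩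
  have hcard : (Hurwitz.orb σ Finset.univ).card = ℓ := by
    rw [hℓ, ← Hurwitz.map_card_orb_univ, Multiset.card_map]
    rfl
  have hpos := Hurwitz.card_orb_pos (σ := σ) hne
  have h := (Hurwitz.countFormula m Finset.univ σ hne fun _ _ => Finset.mem_univ _).2
    (by rw [hcard, Finset.card_univ, Fintype.card_fin]; omega)
  have hq : ((Fintype.card (Fin n) : ℕ) : ℚ) = n := by rw [Fintype.card_fin]
  rw [Hurwitz.hur_orb_univ, ← hℓ, hq, ← mul_assoc] at h
  rw [← h, Hurwitz.cnt, Hurwitz.wordSum_eq_sum_ofFn, Finset.sum_boole, Nat.card_eq_fintype_card,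
    Fintype.card_subtype]
  simp only [Hurwitz.fac_univ_ofFn_iff]
end
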